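/- For any quantized metric spaces (V₁, L₁) and (V₂, L₂), the quantized Gromov–Hausdorff distance satisfies dist_NC(V₁, V₂) ≤ 2(diam(V₁, L₁) + diam(V₂, L₂)). -/

import Mathlib

open scoped ComplexOrder

noncomputable section

/-- The operator (ℓ² → ℓ²) norm of a complex scalar matrix. -/
noncomputable def scalarOpNorm {m n : Type*} [Fintype m] [Fintype n] [DecidableEq n]
    (γ : Matrix m n ℂ) : ℝ :=
  ‖LinearMap.toContinuousLinearMap (Matrix.toEuclideanLin γ)‖

/-- A matrix order unit space `(V, 1)`: a complex *-vector space with a distinguished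
matrix ordering (given by the graded family of positive cones) and an Archimedean
matrix order unit. -/
structure MOUS : Type 1 where
  carrier : Type
  [acg : AddCommGroup carrier]
  [mod : Module ℂ carrier]
  [sam : StarAddMonoid carrier]
  [sm : StarModule ℂ carrier]
  one : carrier
  pos : ∀ n : ℕ, Set (Matrix (Fin n) (Fin n) carrier)
  pos_add : ∀ n, ∀ v ∈ pos n, ∀ w ∈ pos n, v + w ∈ pos n
  pos_smul : ∀ n (t : ℝ), 0 ≤ t → ∀ v ∈ pos n, (t : ℂ) • v ∈ pos n
  pos_star : ∀ n, ∀ v ∈ pos n, v.conjTranspose = v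
  pos_congr : ∀ n m (γ : Matrix (Fin n) (Fin m) ℂ), ∀ v ∈ pos n,
    (Matrix.of fun i j => ∑ k, ∑ l, (star (γ k i) * γ l j) • v k l) ∈ pos m
  proper : ∀ v : Matrix (Fin 1) (Fin 1) carrier, v ∈ pos 1 → -v ∈ pos 1 → v = 0
  unit_pos : ∀ n, Matrix.diagonal (fun _ => one) ∈ pos n
  orderUnit : ∀ v : carrier, star v = v →
    ∃ t : ℝ, 0 < t ∧
      (Matrix.of fun _ _ => (t : ℂ) • one - v : Matrix (Fin 1) (Fin 1) carrier) ∈ pos 1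
  archimedean : ∀ n (v : Matrix (Fin n) (Fin n) carrier),
    (∀ t : ℝ, 0 < t → v + (t : ℂ) • Matrix.diagonal (fun _ => one) ∈ pos n) → v ∈ pos n

attribute [instance] MOUS.acg MOUS.mod MOUS.sam MOUS.sm

/-- Entrywise application of a linear map to a matrix. -/
def mapMat {V W : Type} [AddCommGroup V] [AddCommGroup W] [Module ℂ V] [Module ℂ W]
    (φ : V →ₗ[ℂ] W) {n : ℕ} (a : Matrix (Fin n) (Fin n) V) : Matrix (Fin n) (Fin n) W :=
  Matrix.of fun i j => φ (a i j)

/-- The direct sum (block diagonal) of two matrices over a vector space. -/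
def dsumMat {V : Type} [AddCommGroup V] {m n : ℕ}
    (v : Matrix (Fin m) (Fin m) V) (w : Matrix (Fin n) (Fin n) V) :
    Matrix (Fin (m + n)) (Fin (m + n)) V :=
  Matrix.reindex finSumFinEquiv finSumFinEquiv (Matrix.fromBlocks v 0 0 w)

/-- The two-sided scalar matrix product `α v β`. -/
def mmulMat {V : Type} [AddCommGroup V] [Module ℂ V] {m n : ℕ}
    (α : Matrix (Fin n) (Fin m) ℂ) (v : Matrix (Fin m) (Fin m) V)
    (β : Matrix (Fin m) (Fin n) ℂ) : Matrix (Fin n) (Fin n) V :=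
  Matrix.of fun i j => ∑ k, ∑ l, (α i k * β l j) • v k l

/-- The unit matrix `1ₙ` in `Mₙ(V)`. -/
def MOUS.unitMat (A : MOUS) (n : ℕ) : Matrix (Fin n) (Fin n) A.carrier :=
  Matrix.diagonal fun _ => A.one

/-- The matrix norm determined by the matrix order:
`‖v‖ = inf { t : [[t1, v], [v*, t1]] ≥ 0 }`. -/
def MOUS.matNorm (A : MOUS) {n : ℕ} (v : Matrix (Fin n) (Fin n) A.carrier) : ℝ :=
  sInf {t : ℝ | (Matrix.reindex finSumFinEquiv finSumFinEquiv
    (Matrix.fromBlocks ((t : ℂ) • A.unitMat n) v v.conjTranspose ((t : ℂ) • A.unitMat n)))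
      ∈ A.pos (n + n)}

/-- A matrix Lipschitz seminorm on a matrix order unit space. -/
structure IsMatrixLipschitzSeminorm (A : MOUS)
    (L : ∀ n : ℕ, Matrix (Fin n) (Fin n) A.carrier → ℝ) : Prop where
  nonneg : ∀ n v, 0 ≤ L n v
  add_le : ∀ n v w, L n (v + w) ≤ L n v + L n w
  smul_eq : ∀ n (c : ℂ) v, L n (c • v) = ‖c‖ * L n v
  null_iff : ∀ n v, L n v = 0 ↔
    ∃ lam : Matrix (Fin n) (Fin n) ℂ, v = Matrix.of fun i j => lam i j • A.one
  dsum_eq : ∀ m n v w, L (m + n) (dsumMat v w) = max (L m v) (L n w)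
  mmul_le : ∀ m n (α : Matrix (Fin n) (Fin m) ℂ) v (β : Matrix (Fin m) (Fin n) ℂ),
    L n (mmulMat α v β) ≤ scalarOpNorm α * L m v * scalarOpNorm β
  star_eq : ∀ n v, L n (Matrix.conjTranspose v) = L n v

/-- A matrix seminorm (finite matrix gauge). -/
structure IsMatrixSeminorm (A : MOUS)
    (N : ∀ n : ℕ, Matrix (Fin n) (Fin n) A.carrier → ℝ) : Prop where
  nonneg : ∀ n v, 0 ≤ N n v
  add_le : ∀ n v w, N n (v + w) ≤ N n v + N n w
  smul_le : ∀ n (c : ℂ) v, N n (c • v) ≤ ‖c‖ * N n v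
  dsum_eq : ∀ m n v w, N (m + n) (dsumMat v w) = max (N m v) (N n w)
  mmul_le : ∀ m n (α : Matrix (Fin n) (Fin m) ℂ) v (β : Matrix (Fin m) (Fin n) ℂ),
    N n (mmulMat α v β) ≤ scalarOpNorm α * N m v * scalarOpNorm β

/-- Linear maps from `V` to `Mₙ(ℂ)`; matrix states live here. -/
abbrev MState (A : MOUS) (n : ℕ) := A.carrier →ₗ[ℂ] Matrix (Fin n) (Fin n) ℂ

/-- The matrix pairing `⟨⟨φ, a⟩⟩ = [φ(a_{ij})] ∈ M_{rn}(ℂ)`. -/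
def mpair {A : MOUS} {n r : ℕ} (φ : MState A n) (a : Matrix (Fin r) (Fin r) A.carrier) :
    Matrix (Fin r × Fin n) (Fin r × Fin n) ℂ :=
  Matrix.of fun p q => φ (a p.1 q.1) p.2 q.2

/-- The `n`-th matrix state space: unital completely positive maps `V → Mₙ(ℂ)`. -/
def CS (A : MOUS) (n : ℕ) : Set (MState A n) :=
  {φ | φ A.one = 1 ∧ ∀ r, ∀ v ∈ A.pos r, (mpair φ v).PosSemidef}

/-- The matrix metric `D_{Lₙ}` on matrix states coming from a matrix Lipschitz seminorm. -/
def Dmet (A : MOUS) (L : ∀ n : ℕ, Matrix (Fin n) (Fin n) A.carrier → ℝ) (n : ℕ)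
    (φ ψ : MState A n) : ℝ :=
  sSup {x | ∃ (r : ℕ) (a : Matrix (Fin r) (Fin r) A.carrier), L r a ≤ 1 ∧
    x = scalarOpNorm (mpair φ a - mpair ψ a)}

/-- The BW (pointwise, weak-*) topology on the space of linear maps `V → Mₙ(ℂ)`. -/
def lmTop (A : MOUS) (n : ℕ) : TopologicalSpace (MState A n) :=
  TopologicalSpace.induced (fun φ => (φ : A.carrier → Matrix (Fin n) (Fin n) ℂ)) inferInstance

/-- The BW topology on the matrix state space. -/
def BWtop (A : MOUS) (n : ℕ) : TopologicalSpace {φ : MState A n // φ ∈ CS A n} :=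
  TopologicalSpace.induced Subtype.val (lmTop A n)

/-- The topology on the matrix state space defined by the matrix metric `D_L`. -/
def Dtop (A : MOUS) (L : ∀ n : ℕ, Matrix (Fin n) (Fin n) A.carrier → ℝ) (n : ℕ) :
    TopologicalSpace {φ : MState A n // φ ∈ CS A n} :=
  TopologicalSpace.generateFrom
    {U | ∃ (φ₀ : {φ : MState A n // φ ∈ CS A n}) (ε : ℝ), 0 < ε ∧
      U = {ψ | Dmet A L n φ₀.1 ψ.1 < ε}}

/-- A matrix Lip-norm: a matrix Lipschitz seminorm for which the `D_L`-topology on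
each matrix state space agrees with the BW-topology. -/
structure IsMatrixLipNorm (A : MOUS)
    (L : ∀ n : ℕ, Matrix (Fin n) (Fin n) A.carrier → ℝ)
    extends IsMatrixLipschitzSeminorm A L : Prop where
  top_eq : ∀ n, Dtop A L n = BWtop A n

/-- A unital completely positive linear map between matrix order unit spaces. -/
structure IsUCP (A B : MOUS) (φ : A.carrier →ₗ[ℂ] B.carrier) : Prop where
  unital : φ A.one = B.one
  cp : ∀ n, ∀ v ∈ A.pos n, mapMat φ v ∈ B.pos n

/-- `L` induces `LB` via the (surjective, UCP) map `φ`: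
`LB` is the corresponding family of quotient seminorms. -/
def Induces (A B : MOUS) (φ : A.carrier →ₗ[ℂ] B.carrier)
    (L : ∀ n : ℕ, Matrix (Fin n) (Fin n) A.carrier → ℝ)
    (LB : ∀ n : ℕ, Matrix (Fin n) (Fin n) B.carrier → ℝ) : Prop :=
  ∀ n (b : Matrix (Fin n) (Fin n) B.carrier),
    LB n b = sInf {x | ∃ a, mapMat φ a = b ∧ x = L n a}

/-- The quotient seminorm of `L` via `φ`. -/
def quotSeminorm (A B : MOUS) (φ : A.carrier →ₗ[ℂ] B.carrier)
    (L : ∀ n : ℕ, Matrix (Fin n) (Fin n) A.carrier → ℝ) (n : ℕ)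
    (b : Matrix (Fin n) (Fin n) B.carrier) : ℝ :=
  sInf {x | ∃ a, mapMat φ a = b ∧ x = L n a}

/-- The operator space (matrix order unit space) direct sum `V₁ ⊕ V₂`. -/
def MOUS.prod (A B : MOUS) : MOUS where
  carrier := A.carrier × B.carrier
  one := (A.one, B.one)
  pos n := {v | (Matrix.of fun i j => (v i j).1) ∈ A.pos n ∧
    (Matrix.of fun i j => (v i j).2) ∈ B.pos n}
  pos_add := by
    rintro n v ⟨hv1, hv2⟩ w ⟨hw1, hw2⟩
    exact ⟨A.pos_add n _ hv1 _ hw1, B.pos_add n _ hv2 _ hw2⟩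
  pos_smul := by
    rintro n t ht v ⟨hv1, hv2⟩
    exact ⟨A.pos_smul n t ht _ hv1, B.pos_smul n t ht _ hv2⟩
  pos_star := by
    rintro n v ⟨hv1, hv2⟩
    have h1 := A.pos_star n _ hv1
    have h2 := B.pos_star n _ hv2
    funext i j
    exact Prod.ext (congrFun (congrFun h1 i) j) (congrFun (congrFun h2 i) j)
  pos_congr := by
    rintro n m γ v ⟨hv1, hv2⟩
    constructor
    · have h1 := A.pos_congr n m γ _ hv1
      convert h1 using 2
      funext i j
      simp [Prod.fst_sum]
    · have h2 := B.pos_congr n m γ _ hv2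
      convert h2 using 2
      funext i j
      simp [Prod.snd_sum]
  proper := by
    rintro v ⟨h1, h2⟩ ⟨h3, h4⟩
    have e1 := A.proper _ h1 h3
    have e2 := B.proper _ h2 h4
    funext i j
    exact Prod.ext (congrFun (congrFun e1 i) j) (congrFun (congrFun e2 i) j)
  unit_pos := by
    intro n
    constructor
    · convert A.unit_pos n using 2
      funext i j
      by_cases hij : i = j <;> simp [Matrix.diagonal_apply, hij]
    · convert B.unit_pos n using 2
      funext i j
      by_cases hij : i = j <;> simp [Matrix.diagonal_apply, hij]
  orderUnit := by
    rintro ⟨a, b⟩ hstar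
    have ha : star a = a := congrArg Prod.fst hstar
    have hb : star b = b := congrArg Prod.snd hstar
    obtain ⟨t₁, ht₁, hp₁⟩ := A.orderUnit a ha
    obtain ⟨t₂, ht₂, hp₂⟩ := B.orderUnit b hb
    have huA : (Matrix.of fun _ _ => A.one : Matrix (Fin 1) (Fin 1) A.carrier) ∈ A.pos 1 := by
      convert A.unit_pos 1 using 2
      funext i j
      simp [Matrix.diagonal_apply, Subsingleton.elim i j]
    have huB : (Matrix.of fun _ _ => B.one : Matrix (Fin 1) (Fin 1) B.carrier) ∈ B.pos 1 := by
      convert B.unit_pos 1 using 2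
      funext i j
      simp [Matrix.diagonal_apply, Subsingleton.elim i j]
    refine ⟨t₁ + t₂, add_pos ht₁ ht₂, ?_, ?_⟩
    · have e : (Matrix.of fun _ _ => ((t₁ + t₂ : ℝ) : ℂ) • A.one - a :
          Matrix (Fin 1) (Fin 1) A.carrier)
          = (Matrix.of fun _ _ => (t₁ : ℂ) • A.one - a) +
            (t₂ : ℂ) • (Matrix.of fun _ _ => A.one) := by
        funext i j
        show ((t₁ + t₂ : ℝ) : ℂ) • A.one - a
          = ((t₁ : ℂ) • A.one - a) + (t₂ : ℂ) • A.one
        push_cast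
        rw [add_smul]
        abel
      exact e ▸ A.pos_add 1 _ hp₁ _ (A.pos_smul 1 t₂ ht₂.le _ huA)
    · have e : (Matrix.of fun _ _ => ((t₁ + t₂ : ℝ) : ℂ) • B.one - b :
          Matrix (Fin 1) (Fin 1) B.carrier)
          = (Matrix.of fun _ _ => (t₂ : ℂ) • B.one - b) +
            (t₁ : ℂ) • (Matrix.of fun _ _ => B.one) := by
        funext i j
        show ((t₁ + t₂ : ℝ) : ℂ) • B.one - b
          = ((t₂ : ℂ) • B.one - b) + (t₁ : ℂ) • B.one
        push_cast
        rw [add_smul]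
        abel
      exact e ▸ B.pos_add 1 _ hp₂ _ (B.pos_smul 1 t₁ ht₁.le _ huB)
  archimedean := by
    rintro n v h
    constructor
    · apply A.archimedean
      intro t ht
      have h1 := (h t ht).1
      have e : (Matrix.of fun i j =>
            (((v + (t : ℂ) • Matrix.diagonal fun _ =>
              ((A.one, B.one) : A.carrier × B.carrier) :
                Matrix (Fin n) (Fin n) (A.carrier × B.carrier))) i j).1)
          = (Matrix.of fun i j => (v i j).1) +
            (t : ℂ) • Matrix.diagonal fun _ => A.one := by
        funext i j
        by_cases hij : i = j <;>
          simp [Matrix.add_apply, Matrix.smul_apply, Matrix.diagonal_apply, hij]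
      rw [e] at h1
      exact h1
    · apply B.archimedean
      intro t ht
      have h2 := (h t ht).2
      have e : (Matrix.of fun i j =>
            (((v + (t : ℂ) • Matrix.diagonal fun _ =>
              ((A.one, B.one) : A.carrier × B.carrier) :
                Matrix (Fin n) (Fin n) (A.carrier × B.carrier))) i j).2)
          = (Matrix.of fun i j => (v i j).2) +
            (t : ℂ) • Matrix.diagonal fun _ => B.one := by
        funext i j
        by_cases hij : i = j <;>
          simp [Matrix.add_apply, Matrix.smul_apply, Matrix.diagonal_apply, hij]
      rw [e] at h2
      exact h2

/-- First coordinate projection `V₁ ⊕ V₂ → V₁`. -/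
def fstL (A B : MOUS) : (A.prod B).carrier →ₗ[ℂ] A.carrier :=
  LinearMap.fst ℂ A.carrier B.carrier

/-- Second coordinate projection `V₁ ⊕ V₂ → V₂`. -/
def sndL (A B : MOUS) : (A.prod B).carrier →ₗ[ℂ] B.carrier :=
  LinearMap.snd ℂ A.carrier B.carrier

/-- `M(L₁, L₂)`: the set of matrix Lip-norms on `V₁ ⊕ V₂` inducing `L₁` and `L₂`
via the coordinate projections. -/
def MSet (A : MOUS) (LA : ∀ n : ℕ, Matrix (Fin n) (Fin n) A.carrier → ℝ)
    (B : MOUS) (LB : ∀ n : ℕ, Matrix (Fin n) (Fin n) B.carrier → ℝ) :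
    Set (∀ n : ℕ, Matrix (Fin n) (Fin n) (A.prod B).carrier → ℝ) :=
  {L | IsMatrixLipNorm (A.prod B) L ∧ Induces (A.prod B) A (fstL A B) L LA ∧
    Induces (A.prod B) B (sndL A B) L LB}

/-- Hausdorff distance between two sets with respect to a distance function. -/
def hDist {X : Type} (d : X → X → ℝ) (s t : Set X) : ℝ :=
  max (sSup ((fun x => sInf ((fun y => d x y) '' t)) '' s))
      (sSup ((fun y => sInf ((fun x => d x y) '' s)) '' t))

/-- The quantized Gromov–Hausdorff distance between two quantized metric spaces. -/
def distNC (A : MOUS) (LA : ∀ n : ℕ, Matrix (Fin n) (Fin n) A.carrier → ℝ)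
    (B : MOUS) (LB : ∀ n : ℕ, Matrix (Fin n) (Fin n) B.carrier → ℝ) : ℝ :=
  sInf {x | ∃ L ∈ MSet A LA B LB, x = ⨆ n : ℕ, ((n : ℝ) ^ 2)⁻¹ *
    hDist (Dmet (A.prod B) L n)
      ((fun φ : MState A n => φ.comp (fstL A B)) '' CS A n)
      ((fun φ : MState B n => φ.comp (sndL A B)) '' CS B n)}

/-- The diameter of a quantized metric space: the diameter of `CS₁(V)` for `D_{L₁}`. -/
def qDiam (A : MOUS) (LA : ∀ n : ℕ, Matrix (Fin n) (Fin n) A.carrier → ℝ) : ℝ :=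
  sSup {x | ∃ φ ∈ CS A 1, ∃ ψ ∈ CS A 1, x = Dmet A LA 1 φ ψ}

/-- Lower semicontinuity of a family of matrix seminorms for the order-unit matrix norms. -/
def IsLSCsem (A : MOUS) (L : ∀ n : ℕ, Matrix (Fin n) (Fin n) A.carrier → ℝ) : Prop :=
  ∀ n (a : Matrix (Fin n) (Fin n) A.carrier) (c : ℝ), c < L n a →
    ∃ δ : ℝ, 0 < δ ∧ ∀ b, A.matNorm (b - a) < δ → c < L n b



section ScalarOpNorm

set_option linter.unusedSectionVars false

open scoped Matrix.Norms.L2Operator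

variable {l m n : Type*} [Fintype l] [Fintype m] [Fintype n] [DecidableEq l] [DecidableEq m]
  [DecidableEq n]

lemma scalarOpNorm_eq_norm (X : Matrix m n ℂ) : scalarOpNorm X = ‖X‖ := rfl

lemma scalarOpNorm_nonneg (X : Matrix m n ℂ) : 0 ≤ scalarOpNorm X := norm_nonneg _

lemma scalarOpNorm_add_le (X Y : Matrix m n ℂ) :
    scalarOpNorm (X + Y) ≤ scalarOpNorm X + scalarOpNorm Y := by
  simpa only [scalarOpNorm_eq_norm] using norm_add_le X Y

lemma scalarOpNorm_smul (c : ℂ) (X : Matrix m n ℂ) :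
    scalarOpNorm (c • X) = ‖c‖ * scalarOpNorm X := by
  simpa only [scalarOpNorm_eq_norm] using norm_smul c X

lemma scalarOpNorm_zero : scalarOpNorm (0 : Matrix m n ℂ) = 0 := by
  simp only [scalarOpNorm_eq_norm, norm_zero]

lemma scalarOpNorm_sub_comm (X Y : Matrix m n ℂ) :
    scalarOpNorm (X - Y) = scalarOpNorm (Y - X) := by
  simpa only [scalarOpNorm_eq_norm] using norm_sub_rev X Y

lemma scalarOpNorm_eq_zero {X : Matrix m n ℂ} : scalarOpNorm X = 0 ↔ X = 0 := by
  simpa only [scalarOpNorm_eq_norm] using norm_eq_zero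

lemma scalarOpNorm_mul_le (X : Matrix l m ℂ) (Y : Matrix m n ℂ) :
    scalarOpNorm (X * Y) ≤ scalarOpNorm X * scalarOpNorm Y :=
  Matrix.l2_opNorm_mul X Y

lemma scalarOpNorm_conjTranspose (X : Matrix m n ℂ) :
    scalarOpNorm X.conjTranspose = scalarOpNorm X :=
  Matrix.l2_opNorm_conjTranspose X

lemma scalarOpNorm_sum_le {ι : Type*} (s : Finset ι) (f : ι → Matrix m n ℂ) :
    scalarOpNorm (∑ i ∈ s, f i) ≤ ∑ i ∈ s, scalarOpNorm (f i) := by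
  simpa only [scalarOpNorm_eq_norm] using norm_sum_le s f

lemma scalarOpNorm_one_le : scalarOpNorm (1 : Matrix n n ℂ) ≤ 1 := by
  rw [scalarOpNorm_eq_norm, ← Matrix.diagonal_one, Matrix.l2_opNorm_diagonal]
  exact (pi_norm_le_iff_of_nonneg zero_le_one).2 fun i => by simp

lemma scalarOpNorm_le_one_of_conjTranspose_mul_self {X : Matrix m n ℂ}
    (h : X.conjTranspose * X = 1) : scalarOpNorm X ≤ 1 := by
  have h1 := Matrix.l2_opNorm_conjTranspose_mul_self X
  rw [h, ← scalarOpNorm_eq_norm, ← scalarOpNorm_eq_norm] at h1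
  have h2 := scalarOpNorm_one_le (n := n)
  nlinarith [scalarOpNorm_nonneg X]

/-- The coordinate isometry attached to an injection of index sets. -/
def coordIsometry (f : m → n) : Matrix n m ℂ := (1 : Matrix n n ℂ).submatrix id f

lemma conjTranspose_coordIsometry_mul_mul {k k' : Type*} (f : k → m) (g : k' → n)
    (X : Matrix m n ℂ) :
    (coordIsometry f).conjTranspose * X * coordIsometry g = X.submatrix f g := by
  ext i j
  simp [coordIsometry, Matrix.mul_apply, Matrix.one_apply]

lemma scalarOpNorm_coordIsometry_le {f : m → n} (hf : Function.Injective f) :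
    scalarOpNorm (coordIsometry f) ≤ 1 := by
  refine scalarOpNorm_le_one_of_conjTranspose_mul_self ?_
  have h := conjTranspose_coordIsometry_mul_mul f f (1 : Matrix n n ℂ)
  rw [Matrix.mul_one] at h
  rw [h, Matrix.submatrix_one _ hf]

lemma scalarOpNorm_mul_mul_le_of_le_one {k : Type*} [Fintype k] [DecidableEq k]
    {X : Matrix k l ℂ} {Y : Matrix m n ℂ}
    (hX : scalarOpNorm X ≤ 1) (hY : scalarOpNorm Y ≤ 1) (Z : Matrix l m ℂ) :
    scalarOpNorm (X * Z * Y) ≤ scalarOpNorm Z := by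
  have h1 := scalarOpNorm_mul_le (X * Z) Y
  have h2 := scalarOpNorm_mul_le X Z
  have := scalarOpNorm_nonneg X
  have := scalarOpNorm_nonneg Y
  have := scalarOpNorm_nonneg Z
  calc _ ≤ scalarOpNorm X * scalarOpNorm Z * scalarOpNorm Y := by grw [h1, h2]
    _ ≤ 1 * scalarOpNorm Z * 1 := by gcongr
    _ = _ := by ring

lemma scalarOpNorm_submatrix_le {l' : Type*} [Fintype l'] [DecidableEq l'] {f : l → m} {g : l' → n}
    (hf : Function.Injective f) (hg : Function.Injective g) (X : Matrix m n ℂ) :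
    scalarOpNorm (X.submatrix f g) ≤ scalarOpNorm X := by
  rw [← conjTranspose_coordIsometry_mul_mul]
  refine scalarOpNorm_mul_mul_le_of_le_one ?_ (scalarOpNorm_coordIsometry_le hg) X
  rw [scalarOpNorm_conjTranspose]
  exact scalarOpNorm_coordIsometry_le hf

lemma scalarOpNorm_le_sum_blocks (X : Matrix (m × n) (m × n) ℂ) :
    scalarOpNorm X ≤
      ∑ k, ∑ l, scalarOpNorm (X.submatrix (fun i : m => (i, k)) fun j => (j, l)) := by
  have hX : X = ∑ k, ∑ l, coordIsometry (fun i : m => (i, k)) *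
      X.submatrix (fun i : m => (i, k)) (fun j => (j, l)) *
        (coordIsometry fun j : m => (j, l)).conjTranspose := by
    ext ⟨i, k⟩ ⟨j, l⟩
    simp [coordIsometry, Matrix.sum_apply, Matrix.mul_apply, Matrix.one_apply,
      Prod.ext_iff, ite_and]
  have hi : ∀ k : n, Function.Injective fun i : m => (i, k) := fun k i j h => (Prod.ext_iff.1 h).1
  conv_lhs => rw [hX]
  refine (scalarOpNorm_sum_le _ _).trans (Finset.sum_le_sum fun k _ => ?_)
  refine (scalarOpNorm_sum_le _ _).trans (Finset.sum_le_sum fun l _ => ?_)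
  refine scalarOpNorm_mul_mul_le_of_le_one (scalarOpNorm_coordIsometry_le (hi k)) ?_ _
  rw [scalarOpNorm_conjTranspose]
  exact scalarOpNorm_coordIsometry_le (hi l)

lemma scalarOpNorm_fromBlocks (X : Matrix m m ℂ) (Y : Matrix n n ℂ) :
    scalarOpNorm (Matrix.fromBlocks X 0 0 Y) = max (scalarOpNorm X) (scalarOpNorm Y) := by
  refine le_antisymm ?_ (max_le ?_ ?_)
  · refine ContinuousLinearMap.opNorm_le_bound _
      (le_max_of_le_left (scalarOpNorm_nonneg X)) fun x => ?_
    have hX := Matrix.l2_opNorm_mulVec X (WithLp.toLp 2 fun i => x (Sum.inl i))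
    have hY := Matrix.l2_opNorm_mulVec Y (WithLp.toLp 2 fun i => x (Sum.inr i))
    rw [← scalarOpNorm_eq_norm] at hX hY
    set M := max (scalarOpNorm X) (scalarOpNorm Y)
    have hM : 0 ≤ M := le_max_of_le_left (scalarOpNorm_nonneg X)
    have hX' := hX.trans (mul_le_mul_of_nonneg_right (le_max_left _ _ : _ ≤ M) (norm_nonneg _))
    have hY' := hY.trans (mul_le_mul_of_nonneg_right (le_max_right _ _ : _ ≤ M) (norm_nonneg _))
    refine (sq_le_sq₀ (norm_nonneg _) (by positivity)).1 ?_
    have h1 := pow_le_pow_left₀ (norm_nonneg _) hX' 2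
    have h2 := pow_le_pow_left₀ (norm_nonneg _) hY' 2
    rw [mul_pow, EuclideanSpace.norm_sq_eq, EuclideanSpace.norm_sq_eq] at h1 h2 ⊢
    rw [Fintype.sum_sum_type, Fintype.sum_sum_type, mul_add]
    refine (add_le_add ?_ ?_).trans (add_le_add h1 h2)
    · refine le_of_eq (Finset.sum_congr rfl fun i _ => ?_)
      simp [Matrix.toLpLin_apply, Matrix.mulVec, dotProduct]
    · refine le_of_eq (Finset.sum_congr rfl fun i _ => ?_)
      simp [Matrix.toLpLin_apply, Matrix.mulVec, dotProduct]
  · exact scalarOpNorm_submatrix_le Sum.inl_injective Sum.inl_injective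
      (Matrix.fromBlocks X 0 0 Y)
  · exact scalarOpNorm_submatrix_le Sum.inr_injective Sum.inr_injective
      (Matrix.fromBlocks X 0 0 Y)

lemma scalarOpNorm_reindex (e : m ≃ n) (X : Matrix m m ℂ) :
    scalarOpNorm (Matrix.reindex e e X) = scalarOpNorm X := by
  refine le_antisymm (scalarOpNorm_submatrix_le e.symm.injective e.symm.injective X) ?_
  have h := scalarOpNorm_submatrix_le e.injective e.injective (Matrix.reindex e e X)
  simpa using h

end ScalarOpNorm

lemma norm_apply_le_scalarOpNorm {m n : Type*} [Fintype m] [Fintype n] [DecidableEq m]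
    [DecidableEq n] (X : Matrix m n ℂ) (i : m) (j : n) : ‖X i j‖ ≤ scalarOpNorm X := by
  have h := scalarOpNorm_submatrix_le (f := fun _ : Unit => i) (g := fun _ : Unit => j)
    (fun _ _ _ => rfl) (fun _ _ _ => rfl) X
  have h2 : X.submatrix (fun _ : Unit => i) (fun _ : Unit => j) =
      Matrix.diagonal fun _ => X i j := by
    ext a b
    simp [Subsingleton.elim a b]
  rw [h2, scalarOpNorm_eq_norm, Matrix.l2_opNorm_diagonal] at h
  exact (norm_le_pi_norm (fun _ : Unit => X i j) ()).trans h

section Pairing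

variable {A : MOUS} {n r : ℕ}

lemma mpair_add (φ ψ : MState A n) (a : Matrix (Fin r) (Fin r) A.carrier) :
    mpair (φ + ψ) a = mpair φ a + mpair ψ a := rfl

lemma mpair_sub (φ ψ : MState A n) (a : Matrix (Fin r) (Fin r) A.carrier) :
    mpair (φ - ψ) a = mpair φ a - mpair ψ a := rfl

lemma mpair_smul (c : ℂ) (φ : MState A n) (a : Matrix (Fin r) (Fin r) A.carrier) :
    mpair (c • φ) a = c • mpair φ a := rfl

lemma mpair_smul_right (c : ℂ) (φ : MState A n) (a : Matrix (Fin r) (Fin r) A.carrier) :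
    mpair φ (c • a) = c • mpair φ a := by
  ext p q
  simp [mpair]

/-- The segment between two linear maps into matrices. -/
def segState (φ ψ : MState A n) (t : ℝ) : MState A n :=
  ((1 - t : ℝ) : ℂ) • φ + (t : ℂ) • ψ

lemma segState_mem_CS {φ ψ : MState A n} (hφ : φ ∈ CS A n) (hψ : ψ ∈ CS A n) {t : ℝ}
    (h0 : 0 ≤ t) (h1 : t ≤ 1) : segState φ ψ t ∈ CS A n := by
  refine ⟨?_, fun r v hv => ?_⟩
  · rw [segState, LinearMap.add_apply, LinearMap.smul_apply, LinearMap.smul_apply, hφ.1, hψ.1,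
      ← add_smul]
    simp
  · rw [segState, mpair_add, mpair_smul, mpair_smul]
    refine ((hφ.2 r v hv).smul ?_).add ((hψ.2 r v hv).smul ?_)
    · exact Complex.zero_le_real.2 (by linarith)
    · exact Complex.zero_le_real.2 h0

lemma segState_sub_segState (φ ψ : MState A n) (s t : ℝ) :
    segState φ ψ s - segState φ ψ t = ((t - s : ℝ) : ℂ) • (φ - ψ) := by
  simp only [segState]
  push_cast
  module

lemma sub_segState (φ ψ : MState A n) (t : ℝ) :
    φ - segState φ ψ t = (t : ℂ) • (φ - ψ) := by
  simp only [segState]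
  push_cast
  module

/-- States in scalar-valued form: unital completely positive functionals. -/
def IsState (A : MOUS) (f : A.carrier →ₗ[ℂ] ℂ) : Prop :=
  f A.one = 1 ∧ ∀ r, ∀ v ∈ A.pos r, (v.map f).PosSemidef

/-- The vector functional `a ↦ ⟨φ(a) ξ, ξ⟩`. -/
def vecFunctional (φ : MState A n) (ξ : Fin n → ℂ) : A.carrier →ₗ[ℂ] ℂ where
  toFun a := star ξ ⬝ᵥ (φ a).mulVec ξ
  map_add' a b := by rw [map_add, Matrix.add_mulVec, dotProduct_add]
  map_smul' c a := by
    rw [map_smul, Matrix.smul_mulVec, dotProduct_smul, RingHom.id_apply]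

lemma vecFunctional_isState {φ : MState A n} (hφ : φ ∈ CS A n) {ξ : Fin n → ℂ}
    (hξ : star ξ ⬝ᵥ ξ = 1) : IsState A (vecFunctional φ ξ) := by
  refine ⟨?_, fun r v hv => ?_⟩
  · simp [vecFunctional, hφ.1, hξ]
  · let C : Matrix (Fin r × Fin n) (Fin r) ℂ := Matrix.of fun p j => if p.1 = j then ξ p.2 else 0
    have h : v.map (vecFunctional φ ξ) = C.conjTranspose * mpair φ v * C := by
      ext i j
      simp only [vecFunctional, LinearMap.coe_mk, AddHom.coe_mk, Matrix.map_apply, C,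
        Matrix.mul_apply, Matrix.conjTranspose_apply, Matrix.of_apply, mpair,
        Fintype.sum_prod_type, dotProduct, Matrix.mulVec, Finset.mul_sum, Finset.sum_mul,
        Pi.star_apply]
      simp only [mul_ite, mul_zero, apply_ite star, star_zero, ite_mul, zero_mul]
      rw [Finset.sum_eq_single j (fun b _ hb => by simp [hb]) (by simp), Finset.sum_comm]
      refine Finset.sum_congr rfl fun k _ => ?_
      rw [Finset.sum_eq_single i (fun b _ hb => by simp [hb]) (by simp)]
      simp [mul_assoc]
    rw [h]
    exact (hφ.2 r v hv).conjTranspose_mul_mul_same C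

lemma mpair_smulRight (f : A.carrier →ₗ[ℂ] ℂ) (Q : Matrix (Fin n) (Fin n) ℂ)
    (a : Matrix (Fin r) (Fin r) A.carrier) :
    mpair (f.smulRight Q : MState A n) a = Matrix.kronecker (a.map f) Q := rfl

lemma IsState.smulRight_posSemidef {f : A.carrier →ₗ[ℂ] ℂ} (hf : IsState A f)
    {Q : Matrix (Fin n) (Fin n) ℂ} (hQ : Q.PosSemidef) {v : Matrix (Fin r) (Fin r) A.carrier}
    (hv : v ∈ A.pos r) : (mpair (f.smulRight Q : MState A n) v).PosSemidef := by
  rw [mpair_smulRight]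
  exact (hf.2 r v hv).kronecker hQ

lemma IsState.smulRight_one_mem_CS {f : A.carrier →ₗ[ℂ] ℂ} (hf : IsState A f) (n : ℕ) :
    (f.smulRight (1 : Matrix (Fin n) (Fin n) ℂ) : MState A n) ∈ CS A n :=
  ⟨by simp [hf.1], fun _ _ hv => hf.smulRight_posSemidef Matrix.PosSemidef.one hv⟩

lemma const_mem_pos {v : A.carrier} (h : (Matrix.of fun _ _ => v : Matrix (Fin 1) (Fin 1) _) ∈
    A.pos 1) {f : A.carrier →ₗ[ℂ] ℂ} (hf : IsState A f) : 0 ≤ f v := by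
  have := (hf.2 1 _ h).diag_nonneg (i := 0)
  simpa using this

lemma exists_bound_of_isSelfAdjoint {v : A.carrier} (hv : star v = v) :
    ∃ C : ℝ, ∀ f, IsState A f → (f v).im = 0 ∧ |(f v).re| ≤ C := by
  obtain ⟨s, hs, hs'⟩ := A.orderUnit v hv
  obtain ⟨t, ht, ht'⟩ := A.orderUnit (-v) (by rw [star_neg, hv])
  refine ⟨max s t, fun f hf => ?_⟩
  have h1 := const_mem_pos hs' hf
  have h2 := const_mem_pos ht' hf
  rw [map_sub, map_smul, hf.1, Complex.le_def] at h1 h2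
  simp at h1 h2
  refine ⟨h1.2, abs_le.2 ⟨?_, ?_⟩⟩
  · have := le_max_right s t
    linarith
  · have := le_max_left s t
    linarith

lemma exists_selfAdjoint_decomposition (a : A.carrier) : ∃ x y : A.carrier, star x = x ∧
    star y = y ∧ a = x + Complex.I • y := by
  refine ⟨(1 / 2 : ℂ) • (a + star a), (-Complex.I / 2) • (a - star a), ?_, ?_, ?_⟩
  · simp [star_smul, add_comm]
  · rw [star_smul, star_sub, star_star, ← neg_sub, smul_neg, ← neg_smul]
    congr 1
    simp [neg_div]
  · rw [smul_smul]
    have : Complex.I * (-Complex.I / 2) = 1 / 2 := by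
      linear_combination (-1 / 2 : ℂ) * Complex.I_mul_I
    rw [this]
    module

lemma IsState.map_star {f : A.carrier →ₗ[ℂ] ℂ} (hf : IsState A f) (a : A.carrier) :
    f (star a) = star (f a) := by
  obtain ⟨x, y, hx, hy, rfl⟩ := exists_selfAdjoint_decomposition a
  obtain ⟨_, h1⟩ := exists_bound_of_isSelfAdjoint hx
  obtain ⟨_, h2⟩ := exists_bound_of_isSelfAdjoint hy
  have h1 := (h1 f hf).1
  have h2 := (h2 f hf).1
  rw [star_add, star_smul, hx, hy, map_add, map_smul, map_add, map_smul]
  apply Complex.ext <;> simp [h1, h2]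

lemma exists_bound_of_isState (a : A.carrier) : ∃ C : ℝ, ∀ f, IsState A f → ‖f a‖ ≤ C := by
  obtain ⟨x, y, hx, hy, rfl⟩ := exists_selfAdjoint_decomposition a
  obtain ⟨C, h1⟩ := exists_bound_of_isSelfAdjoint hx
  obtain ⟨D, h2⟩ := exists_bound_of_isSelfAdjoint hy
  refine ⟨C + D, fun f hf => ?_⟩
  have key : ∀ z : ℂ, ∀ E : ℝ, z.im = 0 ∧ |z.re| ≤ E → ‖z‖ ≤ E := by
    rintro z E ⟨h, h'⟩
    rwa [← Complex.abs_re_eq_norm.2 h]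
  rw [map_add, map_smul]
  refine (norm_add_le _ _).trans (add_le_add (key _ _ (h1 f hf)) ?_)
  rw [norm_smul, Complex.norm_I, one_mul]
  exact key _ _ (h2 f hf)

end Pairing

section Metric

variable {A : MOUS} {L : ∀ n : ℕ, Matrix (Fin n) (Fin n) A.carrier → ℝ} {n : ℕ}

/-- `C` bounds the supremum that defines `D_L(φ, ψ)`. -/
def DBound (A : MOUS) (L : ∀ n : ℕ, Matrix (Fin n) (Fin n) A.carrier → ℝ) {n : ℕ}
    (φ ψ : MState A n) (C : ℝ) : Prop :=
  ∀ (r : ℕ) (a : Matrix (Fin r) (Fin r) A.carrier), L r a ≤ 1 →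
    scalarOpNorm (mpair φ a - mpair ψ a) ≤ C

lemma Dmet_nonneg (φ ψ : MState A n) : 0 ≤ Dmet A L n φ ψ := by
  refine Real.sSup_nonneg ?_
  rintro _ ⟨r, a, _, rfl⟩
  exact scalarOpNorm_nonneg _

lemma Dmet_le {φ ψ : MState A n} {C : ℝ} (hC : 0 ≤ C) (h : DBound A L φ ψ C) :
    Dmet A L n φ ψ ≤ C := by
  refine Real.sSup_le ?_ hC
  rintro _ ⟨r, a, ha, rfl⟩
  exact h r a ha

lemma Dmet_self (φ : MState A n) : Dmet A L n φ φ = 0 := by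
  refine le_antisymm (Dmet_le le_rfl fun r a _ => ?_) (Dmet_nonneg φ φ)
  rw [sub_self, scalarOpNorm_zero]

lemma DBound.dmet {φ ψ : MState A n} {C : ℝ} (h : DBound A L φ ψ C) :
    DBound A L φ ψ (Dmet A L n φ ψ) := by
  intro r a ha
  refine le_csSup ⟨C, ?_⟩ ⟨r, a, ha, rfl⟩
  rintro _ ⟨r, a, ha, rfl⟩
  exact h r a ha

lemma Dmet_eq_zero_of_not_bounded {φ ψ : MState A n} (h : ¬ ∃ C, DBound A L φ ψ C) :
    Dmet A L n φ ψ = 0 := by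
  refine Real.sSup_of_not_bddAbove fun ⟨C, hC⟩ => h ⟨C, fun r a ha => hC ⟨r, a, ha, rfl⟩⟩

lemma DBound.symm {φ ψ : MState A n} {C : ℝ} (h : DBound A L φ ψ C) : DBound A L ψ φ C :=
  fun r a ha => by
    rw [scalarOpNorm_sub_comm]
    exact h r a ha

lemma DBound.trans {φ ψ χ : MState A n} {C D : ℝ} (h : DBound A L φ ψ C)
    (h' : DBound A L ψ χ D) : DBound A L φ χ (C + D) := fun r a ha => by
  rw [← sub_add_sub_cancel _ (mpair ψ a)]
  exact (scalarOpNorm_add_le _ _).trans (add_le_add (h r a ha) (h' r a ha))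

/-- Rescaling the difference of two matrix functionals rescales the bounds. -/
lemma DBound.of_sub_eq_smul {φ ψ φ' ψ' : MState A n} {c C : ℝ} (hc : 0 < c)
    (h : DBound A L φ' ψ' C) (e : φ' - ψ' = (c : ℂ) • (φ - ψ)) : DBound A L φ ψ (C / c) := by
  intro r a ha
  have h1 := h r a ha
  rw [← mpair_sub, e, mpair_smul, scalarOpNorm_smul, Complex.norm_of_nonneg hc.le] at h1
  rw [le_div_iff₀ hc, mul_comm]
  exact h1

lemma Dmet_triangle {φ ψ χ : MState A n} {C D : ℝ} (h : DBound A L φ ψ C)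
    (h' : DBound A L ψ χ D) : Dmet A L n φ χ ≤ Dmet A L n φ ψ + Dmet A L n ψ χ :=
  Dmet_le (add_nonneg (Dmet_nonneg _ _) (Dmet_nonneg _ _)) (h.dmet.trans h'.dmet)

lemma tendsto_nhds_BWtop_iff {ι : Type*} {l : Filter ι} {g : ι → {φ : MState A n // φ ∈ CS A n}}
    {Φ : {φ : MState A n // φ ∈ CS A n}} :
    Filter.Tendsto g l (@nhds _ (BWtop A n) Φ) ↔
      ∀ a i j, Filter.Tendsto (fun x => (g x).1 a i j) l (nhds (Φ.1 a i j)) := by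
  unfold BWtop
  rw [@nhds_induced _ _ (lmTop A n), Filter.tendsto_comap_iff]
  unfold lmTop
  rw [nhds_induced, Filter.tendsto_comap_iff, tendsto_pi_nhds]
  refine forall_congr' fun a => ?_
  exact tendsto_pi_nhds.trans (forall_congr' fun i => tendsto_pi_nhds)

lemma tendsto_nhds_Dtop_iff {ι : Type*} {l : Filter ι} {g : ι → {φ : MState A n // φ ∈ CS A n}}
    {Φ : {φ : MState A n // φ ∈ CS A n}} :
    Filter.Tendsto g l (@nhds _ (Dtop A L n) Φ) ↔
      ∀ (χ : {φ : MState A n // φ ∈ CS A n}) (ε : ℝ), 0 < ε → Dmet A L n χ.1 Φ.1 < ε →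
        ∀ᶠ x in l, Dmet A L n χ.1 (g x).1 < ε := by
  unfold Dtop
  rw [TopologicalSpace.tendsto_nhds_generateFrom_iff]
  constructor
  · intro h χ ε hε hΦ
    exact h _ ⟨χ, ε, hε, rfl⟩ hΦ
  · rintro h _ ⟨χ, ε, hε, rfl⟩ hΦ
    exact h χ ε hε hΦ

/-- Convergence in the point-norm topology forces convergence for the matrix metric. -/
lemma IsMatrixLipNorm.eventually_Dmet_lt (hL : IsMatrixLipNorm A L) {ι : Type*} {l : Filter ι}
    {g : ι → {φ : MState A n // φ ∈ CS A n}} {Φ : {φ : MState A n // φ ∈ CS A n}}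
    (h : ∀ a i j, Filter.Tendsto (fun x => (g x).1 a i j) l (nhds (Φ.1 a i j)))
    {ε : ℝ} (hε : 0 < ε) : ∀ᶠ x in l, Dmet A L n Φ.1 (g x).1 < ε := by
  have h1 := tendsto_nhds_BWtop_iff.2 h
  rw [← hL.top_eq n] at h1
  exact tendsto_nhds_Dtop_iff.1 h1 Φ ε hε (by rwa [Dmet_self])

/-- The matrix metric of a matrix Lip-norm is finite: otherwise the points of a segment would be
pairwise at infinite distance and the `D`-topology could not be Hausdorff. -/
lemma IsMatrixLipNorm.exists_DBound (hL : IsMatrixLipNorm A L) {φ ψ : MState A n}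
    (hφ : φ ∈ CS A n) (hψ : ψ ∈ CS A n) : ∃ C, DBound A L φ ψ C := by
  by_contra hne
  let t : ℕ → ℝ := fun k => 1 / ((k : ℝ) + 1)
  have ht0 : ∀ k, 0 ≤ t k := fun k => by positivity
  have ht1 : ∀ k, t k ≤ 1 := fun k => by
    simp only [t]
    rw [div_le_one (by positivity)]
    linarith [Nat.cast_nonneg (α := ℝ) k]
  have htinj : Function.Injective t := fun k l h => by
    simpa [t] using h
  let g : ℕ → {φ : MState A n // φ ∈ CS A n} :=
    fun k => ⟨segState φ ψ (t k), segState_mem_CS hφ hψ (ht0 k) (ht1 k)⟩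
  have key : ∀ χ : MState A n, {k | ∃ C, DBound A L χ (g k).1 C}.Subsingleton := by
    rintro χ k ⟨C, hC⟩ l ⟨D, hD⟩
    by_contra hkl
    have h := hC.symm.trans hD
    have e := segState_sub_segState φ ψ (t k) (t l)
    rcases lt_or_gt_of_ne (fun h => hkl (htinj h)) with hlt | hlt
    · exact hne ⟨_, h.of_sub_eq_smul (sub_pos.2 hlt) e⟩
    · exact hne ⟨_, h.symm.of_sub_eq_smul (sub_pos.2 hlt) (segState_sub_segState φ ψ (t l) (t k))⟩
  have hlim : ∀ Φ : {φ : MState A n // φ ∈ CS A n},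
      Filter.Tendsto g Filter.cofinite (@nhds _ (BWtop A n) Φ) := by
    intro Φ
    rw [← hL.top_eq n]
    refine tendsto_nhds_Dtop_iff.2 fun χ ε hε _ => ?_
    refine Filter.eventually_cofinite.2 ((key χ.1).finite.subset fun k hk => ?_)
    by_contra hb
    exact hk (by rwa [Dmet_eq_zero_of_not_bounded hb])
  have heq : φ = ψ := by
    ext a i j
    exact tendsto_nhds_unique (tendsto_nhds_BWtop_iff.1 (hlim ⟨φ, hφ⟩) a i j)
      (tendsto_nhds_BWtop_iff.1 (hlim ⟨ψ, hψ⟩) a i j)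
  refine hne ⟨0, fun r a _ => ?_⟩
  rw [heq, sub_self, scalarOpNorm_zero]

lemma IsMatrixLipschitzSeminorm.scalarOpNorm_apply_sub_le (hL : IsMatrixLipschitzSeminorm A L)
    {φ ψ : MState A n} {C : ℝ} (h : DBound A L φ ψ C) (a : A.carrier) (i j : Fin n) :
    ‖φ a i j - ψ a i j‖ ≤ C * (L 1 (Matrix.of fun _ _ => a) + 1) := by
  set v : Matrix (Fin 1) (Fin 1) A.carrier := Matrix.of fun _ _ => a
  have hs : 0 < L 1 v + 1 := by linarith [hL.nonneg 1 v]
  have h1 := h 1 (((L 1 v + 1)⁻¹ : ℝ) • v : Matrix (Fin 1) (Fin 1) A.carrier)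
  have e : (((L 1 v + 1)⁻¹ : ℝ) • v : Matrix (Fin 1) (Fin 1) A.carrier) =
    (((L 1 v + 1)⁻¹ : ℝ) : ℂ) • v := rfl
  rw [e, hL.smul_eq, ← mpair_sub, mpair_smul_right, scalarOpNorm_smul,
    Complex.norm_of_nonneg (by positivity)] at h1
  have h2 := h1 (by
    rw [inv_mul_le_iff₀ hs]
    linarith)
  rw [inv_mul_le_iff₀ hs] at h2
  have h3 := norm_apply_le_scalarOpNorm (mpair (φ - ψ) v) (0, i) (0, j)
  have h4 := h3.trans h2
  rw [mul_comm] at h4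
  exact h4

lemma Dtop_eq_BWtop_of_eventually (hL : IsMatrixLipschitzSeminorm A L)
    (hb : ∀ φ ∈ CS A n, ∀ ψ ∈ CS A n, ∃ C, DBound A L φ ψ C)
    (hc : ∀ (Φ : {φ : MState A n // φ ∈ CS A n}) (ε : ℝ), 0 < ε →
      ∀ᶠ Ψ in @nhds _ (BWtop A n) Φ, Dmet A L n Φ.1 Ψ.1 < ε) :
    Dtop A L n = BWtop A n := by
  refine TopologicalSpace.ext_nhds fun Φ => le_antisymm ?_ ?_
  · refine tendsto_nhds_BWtop_iff (g := id).2 fun a i j => Metric.tendsto_nhds.2 fun ε hε => ?_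
    set K := L 1 (Matrix.of fun _ _ => a) + 1
    have hK : 0 < K := by linarith [hL.nonneg 1 (Matrix.of fun _ _ => a)]
    have h := tendsto_nhds_Dtop_iff (L := L) (l := @nhds _ (Dtop A L n) Φ) (g := id).1
      Filter.tendsto_id Φ (ε / K) (by positivity) (by
        rw [Dmet_self]
        positivity)
    filter_upwards [h] with Ψ hΨ
    obtain ⟨C, hC⟩ := hb Φ.1 Φ.2 Ψ.1 Ψ.2
    rw [dist_comm, dist_eq_norm]
    exact (hL.scalarOpNorm_apply_sub_le hC.dmet a i j).trans_lt ((lt_div_iff₀ hK).1 hΨ)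
  · refine tendsto_nhds_Dtop_iff (g := id).2 fun χ ε hε hΦ => ?_
    filter_upwards [hc Φ (ε - Dmet A L n χ.1 Φ.1) (sub_pos.2 hΦ)] with Ψ hΨ
    obtain ⟨C, hC⟩ := hb χ.1 χ.2 Φ.1 Φ.2
    obtain ⟨D, hD⟩ := hb Φ.1 Φ.2 Ψ.1 Ψ.2
    have := Dmet_triangle hC hD
    simp only [id]
    linarith

lemma isState_of_mem_CS_one {φ : MState A 1} (hφ : φ ∈ CS A 1) :
    IsState A (vecFunctional φ 1) :=
  vecFunctional_isState hφ (by simp)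

lemma exists_bound_CS_one (a : A.carrier) (i j : Fin 1) : ∃ C : ℝ, ∀ φ ∈ CS A 1, ‖φ a i j‖ ≤ C := by
  obtain ⟨C, hC⟩ := exists_bound_of_isState a
  refine ⟨C, fun φ hφ => ?_⟩
  have h := hC _ (isState_of_mem_CS_one hφ)
  rw [Subsingleton.elim i 0, Subsingleton.elim j 0]
  simpa [vecFunctional, Matrix.mulVec, dotProduct] using h

set_option maxHeartbeats 1000000 in
lemma IsMatrixLipNorm.exists_Dmet_le (hL : IsMatrixLipNorm A L) {φ : MState A 1}
    (hφ : φ ∈ CS A 1) : ∃ C, ∀ ψ ∈ CS A 1, Dmet A L 1 φ ψ ≤ C := by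
  by_contra! hne
  choose χ hχ hlt using fun k : ℕ => hne (k + 1)
  let d : ℕ → ℝ := fun k => Dmet A L 1 φ (χ k)
  have hd : ∀ k : ℕ, (k : ℝ) + 1 < d k := hlt
  have hd0 : ∀ k, 0 < d k := fun k => lt_trans (by positivity) (hd k)
  have hd1 : ∀ k, (d k)⁻¹ ≤ 1 := fun k => inv_le_one_of_one_le₀ (by
    have := hd k
    have := Nat.cast_nonneg (α := ℝ) k
    linarith)
  let g : ℕ → {φ : MState A 1 // φ ∈ CS A 1} := fun k =>
    ⟨segState φ (χ k) (d k)⁻¹, segState_mem_CS hφ (hχ k) (inv_nonneg.2 (hd0 k).le) (hd1 k)⟩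
  have hdlim : Filter.Tendsto (fun k => (d k)⁻¹) Filter.atTop (nhds 0) := by
    refine squeeze_zero (fun k => inv_nonneg.2 (hd0 k).le) (fun k => ?_)
      (tendsto_one_div_add_atTop_nhds_zero_nat (𝕜 := ℝ))
    rw [one_div]
    exact inv_anti₀ (by positivity) (hd k).le
  have hg : ∀ a i j, Filter.Tendsto (fun k => (g k).1 a i j) Filter.atTop (nhds (φ a i j)) := by
    intro a i j
    obtain ⟨C, hC⟩ := exists_bound_CS_one a i j
    rw [tendsto_iff_norm_sub_tendsto_zero]
    refine squeeze_zero (g := fun k => (d k)⁻¹ * (C + C)) (fun _ => norm_nonneg _) (fun k => ?_) ?_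
    · have e : (g k).1 a i j - φ a i j = -(((d k)⁻¹ : ℝ) : ℂ) * (φ a i j - χ k a i j) := by
        have := congrFun (congrFun (LinearMap.congr_fun (sub_segState φ (χ k) (d k)⁻¹) a) i) j
        simp only [LinearMap.sub_apply, LinearMap.smul_apply, Matrix.sub_apply, Matrix.smul_apply,
          smul_eq_mul] at this
        linear_combination -this
      rw [e, norm_mul, norm_neg, Complex.norm_of_nonneg (inv_nonneg.2 (hd0 k).le)]
      gcongr
      · exact inv_nonneg.2 (hd0 k).le
      · exact (norm_sub_le _ _).trans (add_le_add (hC _ hφ) (hC _ (hχ k)))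
    · simpa using hdlim.mul_const (C + C)
  obtain ⟨k, hk⟩ :=
    (hL.eventually_Dmet_lt (Φ := ⟨φ, hφ⟩) (g := g) hg (one_half_pos (α := ℝ))).exists
  obtain ⟨C, hC⟩ := hL.exists_DBound hφ (g k).2
  have h1 := hC.dmet.of_sub_eq_smul (inv_pos.2 (hd0 k)) (sub_segState φ (χ k) (d k)⁻¹)
  have h2 := Dmet_le (by
    have := Dmet_nonneg (L := L) φ (g k).1
    have := hd0 k
    positivity) h1
  have h3 : d k ≤ Dmet A L 1 φ (g k).1 * d k := by
    simpa using h2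
  have := hd0 k
  nlinarith

lemma qDiam_nonneg : 0 ≤ qDiam A L := by
  refine Real.sSup_nonneg ?_
  rintro _ ⟨φ, _, ψ, _, rfl⟩
  exact Dmet_nonneg φ ψ

lemma IsMatrixLipNorm.Dmet_le_qDiam (hL : IsMatrixLipNorm A L) {φ ψ : MState A 1}
    (hφ : φ ∈ CS A 1) (hψ : ψ ∈ CS A 1) : Dmet A L 1 φ ψ ≤ qDiam A L := by
  obtain ⟨C, hC⟩ := hL.exists_Dmet_le hφ
  refine le_csSup ⟨C + C, ?_⟩ ⟨φ, hφ, ψ, hψ, rfl⟩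
  rintro _ ⟨φ', hφ', ψ', hψ', rfl⟩
  obtain ⟨D, hD⟩ := hL.exists_DBound hφ hφ'
  obtain ⟨E, hE⟩ := hL.exists_DBound hφ hψ'
  have hC0 : 0 ≤ C := (Dmet_nonneg _ _).trans (hC _ hφ')
  refine Dmet_le (by linarith) fun r a ha => ?_
  refine (hD.dmet.symm.trans hE.dmet r a ha).trans (add_le_add (hC _ hφ') (hC _ hψ'))

end Metric

lemma scalarOpNorm_kronecker_le {m n : Type*} [Fintype m] [Fintype n] [DecidableEq m]
    [DecidableEq n] (X : Matrix m m ℂ) (Q : Matrix n n ℂ) :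
    scalarOpNorm (Matrix.kronecker X Q) ≤ scalarOpNorm X * ∑ k, ∑ l, ‖Q k l‖ := by
  refine (scalarOpNorm_le_sum_blocks _).trans (le_of_eq ?_)
  simp_rw [Finset.mul_sum]
  refine Finset.sum_congr rfl fun k _ => Finset.sum_congr rfl fun l _ => ?_
  rw [mul_comm, ← scalarOpNorm_smul]
  congr 1
  ext i j
  simp [Matrix.kronecker, mul_comm]

section Diameter

variable {A : MOUS} {L : ∀ n : ℕ, Matrix (Fin n) (Fin n) A.carrier → ℝ} {n r : ℕ}

lemma IsMatrixLipNorm.scalarOpNorm_map_sub_le (hL : IsMatrixLipNorm A L)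
    {f g : A.carrier →ₗ[ℂ] ℂ} (hf : IsState A f) (hg : IsState A g)
    {a : Matrix (Fin r) (Fin r) A.carrier} (ha : L r a ≤ 1) :
    scalarOpNorm (a.map f - a.map g) ≤ qDiam A L := by
  obtain ⟨C, hC⟩ := hL.exists_DBound (hf.smulRight_one_mem_CS 1) (hg.smulRight_one_mem_CS 1)
  refine le_trans ?_ ((hC.dmet r a ha).trans
    (hL.Dmet_le_qDiam (hf.smulRight_one_mem_CS 1) (hg.smulRight_one_mem_CS 1)))
  have hi : Function.Injective fun i : Fin r => (i, (0 : Fin 1)) :=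
    fun i j h => (Prod.ext_iff.1 h).1
  refine le_of_eq_of_le ?_ (scalarOpNorm_submatrix_le hi hi _)
  congr 1
  ext i j
  simp [mpair]

lemma vecFunctional_single_add_single (φ : MState A n) (k l : Fin n) (x y : ℂ) (a : A.carrier) :
    vecFunctional φ (Pi.single k x + Pi.single l y) a =
      star x * x * φ a k k + star x * y * φ a k l + star y * x * φ a l k +
        star y * y * φ a l l := by
  simp only [vecFunctional, LinearMap.coe_mk, AddHom.coe_mk, star_add, Matrix.mulVec_add,
    dotProduct_add, add_dotProduct, ← Pi.single_star, single_dotProduct, Matrix.mulVec_single]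
  simp
  ring

lemma vecFunctional_single_add_single_isState {φ : MState A n} (hφ : φ ∈ CS A n) {k l : Fin n}
    (hkl : k ≠ l) {x y : ℂ} (hxy : star x * x + star y * y = 1) :
    IsState A (vecFunctional φ (Pi.single k x + Pi.single l y)) := by
  refine vecFunctional_isState hφ ?_
  simp only [star_add, dotProduct_add, add_dotProduct, ← Pi.single_star, single_dotProduct]
  simpa [hkl, hkl.symm] using hxy

lemma IsMatrixLipNorm.scalarOpNorm_offDiag_le (hL : IsMatrixLipNorm A L) {φ : MState A n}
    (hφ : φ ∈ CS A n) {k l : Fin n} (hkl : k ≠ l) {a : Matrix (Fin r) (Fin r) A.carrier}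
    (ha : L r a ≤ 1) :
    scalarOpNorm (Matrix.of fun i j => φ (a i j) k l : Matrix (Fin r) (Fin r) ℂ) ≤ qDiam A L := by
  obtain ⟨s, hs⟩ : ∃ s : ℝ, (s : ℂ) * s = 1 / 2 := ⟨Real.sqrt (1 / 2), by
    rw [← Complex.ofReal_mul, Real.mul_self_sqrt (by norm_num)]
    norm_num⟩
  let ω : ℂ → A.carrier →ₗ[ℂ] ℂ := fun y => vecFunctional φ (Pi.single k (s : ℂ) + Pi.single l y)
  have hstar : star (s : ℂ) = s := Complex.conj_ofReal s
  have hI : star Complex.I = -Complex.I := Complex.conj_I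
  have hω : ∀ c : ℂ, star c * c = 1 → IsState A (ω (c * s)) := fun c hc =>
    vecFunctional_single_add_single_isState hφ hkl (by
      rw [star_mul, hstar]
      linear_combination (s : ℂ) * s * hc + 2 * hs)
  have h1 : IsState A (ω (1 * s)) := hω 1 (by simp)
  have h2 : IsState A (ω (-1 * s)) := hω (-1) (by simp)
  have h3 : IsState A (ω (Complex.I * s)) := hω Complex.I (by simp [hI])
  have h4 : IsState A (ω (-Complex.I * s)) := hω (-Complex.I) (by simp [hI])
  have e : (Matrix.of fun i j => φ (a i j) k l : Matrix (Fin r) (Fin r) ℂ) =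
      (1 / 2 : ℂ) • ((a.map (ω (1 * s)) - a.map (ω (-1 * s))) +
        (-Complex.I) • (a.map (ω (Complex.I * s)) - a.map (ω (-Complex.I * s)))) := by
    ext i j
    simp only [Matrix.of_apply, Matrix.smul_apply, Matrix.add_apply, Matrix.sub_apply,
      Matrix.map_apply, ω, vecFunctional_single_add_single, smul_eq_mul, star_mul, hstar,
      star_neg, star_one, hI]
    linear_combination (-2 * φ (a i j) k l) * hs +
      (s * s * (φ (a i j) k l - φ (a i j) l k)) * Complex.I_mul_I
  rw [e, scalarOpNorm_smul]
  have b1 := hL.scalarOpNorm_map_sub_le h1 h2 ha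
  have b2 := hL.scalarOpNorm_map_sub_le h3 h4 ha
  have b3 := scalarOpNorm_add_le (a.map (ω (1 * s)) - a.map (ω (-1 * s)))
    ((-Complex.I) • (a.map (ω (Complex.I * s)) - a.map (ω (-Complex.I * s))))
  rw [scalarOpNorm_smul (-Complex.I), norm_neg, Complex.norm_I] at b3
  have : ‖(1 / 2 : ℂ)‖ = 1 / 2 := by simp
  rw [this]
  linarith

lemma IsMatrixLipNorm.DBound_smulRight_one (hL : IsMatrixLipNorm A L) {φ : MState A n}
    (hφ : φ ∈ CS A n) {f : A.carrier →ₗ[ℂ] ℂ} (hf : IsState A f) :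
    DBound A L φ (f.smulRight 1) ((n : ℝ) ^ 2 * qDiam A L) := by
  intro r a ha
  have hblock : ∀ k l : Fin n, scalarOpNorm ((mpair φ a - mpair (f.smulRight 1) a).submatrix
      (fun i : Fin r => (i, k)) fun j => (j, l)) ≤ qDiam A L := by
    intro k l
    rcases eq_or_ne k l with rfl | hkl
    · have hω : IsState A (vecFunctional φ (Pi.single k 1)) :=
        vecFunctional_isState hφ (by simp)
      refine le_of_eq_of_le ?_ (hL.scalarOpNorm_map_sub_le hω hf ha)
      congr 1
      ext i j
      simp [mpair, vecFunctional]
    · refine le_of_eq_of_le ?_ (hL.scalarOpNorm_offDiag_le hφ hkl ha)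
      congr 1
      ext i j
      simp [mpair, hkl]
  refine (scalarOpNorm_le_sum_blocks _).trans ?_
  refine (Finset.sum_le_sum fun k _ => Finset.sum_le_sum fun l _ => hblock k l).trans ?_
  simp [sq, mul_assoc]

end Diameter

section Glue

variable {A B : MOUS} {LA : ∀ n : ℕ, Matrix (Fin n) (Fin n) A.carrier → ℝ}
  {LB : ∀ n : ℕ, Matrix (Fin n) (Fin n) B.carrier → ℝ}
  {f : A.carrier →ₗ[ℂ] ℂ} {g : B.carrier →ₗ[ℂ] ℂ} {γ : ℝ} {n r : ℕ}

/-- The functional `(a, b) ↦ f(a) - g(b)`. -/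
def bridgeFunctional (f : A.carrier →ₗ[ℂ] ℂ) (g : B.carrier →ₗ[ℂ] ℂ) :
    (A.prod B).carrier →ₗ[ℂ] ℂ :=
  f.comp (fstL A B) - g.comp (sndL A B)

/-- The matrix seminorm on `V₁ ⊕ V₂` joining the two given ones by means of the bridge
`γ⁻¹ ‖f(a) - g(b)‖`. -/
def glueSeminorm (LA : ∀ n : ℕ, Matrix (Fin n) (Fin n) A.carrier → ℝ)
    (LB : ∀ n : ℕ, Matrix (Fin n) (Fin n) B.carrier → ℝ)
    (f : A.carrier →ₗ[ℂ] ℂ) (g : B.carrier →ₗ[ℂ] ℂ) (γ : ℝ) (n : ℕ)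
    (c : Matrix (Fin n) (Fin n) (A.prod B).carrier) : ℝ :=
  max (max (LA n (mapMat (fstL A B) c)) (LB n (mapMat (sndL A B) c)))
    (γ⁻¹ * scalarOpNorm (c.map (bridgeFunctional f g)))

section MapMat

variable {V W : Type} [AddCommGroup V] [AddCommGroup W] [Module ℂ V] [Module ℂ W]
  (φ : V →ₗ[ℂ] W)

lemma mapMat_add (a b : Matrix (Fin n) (Fin n) V) :
    mapMat φ (a + b) = mapMat φ a + mapMat φ b := by
  ext i j
  simp [mapMat]

lemma mapMat_smul (c : ℂ) (a : Matrix (Fin n) (Fin n) V) :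
    mapMat φ (c • a) = c • mapMat φ a := by
  ext i j
  simp [mapMat]

lemma mapMat_dsumMat (a : Matrix (Fin n) (Fin n) V) (b : Matrix (Fin r) (Fin r) V) :
    mapMat φ (dsumMat a b) = dsumMat (mapMat φ a) (mapMat φ b) := by
  ext i j
  simp only [mapMat, dsumMat, Matrix.of_apply, Matrix.reindex_apply, Matrix.submatrix_apply]
  rcases finSumFinEquiv.symm i with i | i <;> rcases finSumFinEquiv.symm j with j | j <;> simp

lemma mapMat_mmulMat (α : Matrix (Fin n) (Fin r) ℂ) (a : Matrix (Fin r) (Fin r) V)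
    (β : Matrix (Fin r) (Fin n) ℂ) : mapMat φ (mmulMat α a β) = mmulMat α (mapMat φ a) β := by
  ext i j
  simp [mapMat, mmulMat]

end MapMat

lemma scalarOpNorm_dsumMat (X : Matrix (Fin n) (Fin n) ℂ) (Y : Matrix (Fin r) (Fin r) ℂ) :
    scalarOpNorm (dsumMat X Y) = max (scalarOpNorm X) (scalarOpNorm Y) := by
  rw [dsumMat, scalarOpNorm_reindex, scalarOpNorm_fromBlocks]

lemma mmulMat_eq_mul (α : Matrix (Fin n) (Fin r) ℂ) (X : Matrix (Fin r) (Fin r) ℂ)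
    (β : Matrix (Fin r) (Fin n) ℂ) : mmulMat α X β = α * X * β := by
  ext i j
  simp only [mmulMat, Matrix.of_apply, Matrix.mul_apply, Finset.sum_mul, smul_eq_mul]
  rw [Finset.sum_comm]
  exact Finset.sum_congr rfl fun _ _ => Finset.sum_congr rfl fun _ _ => by ring

lemma map_eq_mapMat {V : Type} [AddCommGroup V] [Module ℂ V] (h : V →ₗ[ℂ] ℂ)
    (c : Matrix (Fin n) (Fin n) V) : c.map h = mapMat h c := rfl

lemma glueSeminorm_le_iff {c : Matrix (Fin n) (Fin n) (A.prod B).carrier} {C : ℝ} :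
    glueSeminorm LA LB f g γ n c ≤ C ↔ LA n (mapMat (fstL A B) c) ≤ C ∧
      LB n (mapMat (sndL A B) c) ≤ C ∧
        γ⁻¹ * scalarOpNorm (c.map (bridgeFunctional f g)) ≤ C := by
  rw [glueSeminorm, max_le_iff, max_le_iff, and_assoc]

lemma bridgeFunctional_star (hf : IsState A f) (hg : IsState B g) (c : (A.prod B).carrier) :
    bridgeFunctional f g (star c) = star (bridgeFunctional f g c) := by
  obtain ⟨a, b⟩ := c
  change f (star a) - g (star b) = star (f a - g b)
  rw [hf.map_star, hg.map_star, star_sub]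

lemma glueSeminorm_isMatrixLipschitzSeminorm (hA : IsMatrixLipschitzSeminorm A LA)
    (hB : IsMatrixLipschitzSeminorm B LB) (hf : IsState A f) (hg : IsState B g) (hγ : 0 < γ) :
    IsMatrixLipschitzSeminorm (A.prod B) (glueSeminorm LA LB f g γ) := by
  have hγ' : 0 < γ⁻¹ := inv_pos.2 hγ
  refine ⟨fun n v => ?_, fun n v w => ?_, fun n c v => ?_, fun n v => ?_, fun m n v w => ?_,
    fun m n α v β => ?_, fun n v => ?_⟩
  · exact le_max_of_le_left (le_max_of_le_left (hA.nonneg _ _))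
  · obtain ⟨h1, h2, h3⟩ := glueSeminorm_le_iff.1 (le_refl (glueSeminorm LA LB f g γ n v))
    obtain ⟨h1', h2', h3'⟩ := glueSeminorm_le_iff.1 (le_refl (glueSeminorm LA LB f g γ n w))
    refine glueSeminorm_le_iff.2 ⟨?_, ?_, ?_⟩
    · rw [mapMat_add]
      exact (hA.add_le _ _ _).trans (add_le_add h1 h1')
    · rw [mapMat_add]
      exact (hB.add_le _ _ _).trans (add_le_add h2 h2')
    · rw [map_eq_mapMat, mapMat_add]
      refine (mul_le_mul_of_nonneg_left (scalarOpNorm_add_le _ _) hγ'.le).trans ?_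
      rw [mul_add]
      exact add_le_add h3 h3'
  · simp only [glueSeminorm, map_eq_mapMat, mapMat_smul, hA.smul_eq, hB.smul_eq,
      scalarOpNorm_smul]
    rw [mul_max_of_nonneg _ _ (norm_nonneg c), mul_max_of_nonneg _ _ (norm_nonneg c),
      mul_left_comm]
  · constructor
    · intro h
      obtain ⟨h1, h2, h3⟩ := glueSeminorm_le_iff.1 h.le
      obtain ⟨lam, h1⟩ := (hA.null_iff _ _).1 (le_antisymm h1 (hA.nonneg _ _))
      obtain ⟨mu, h2⟩ := (hB.null_iff _ _).1 (le_antisymm h2 (hB.nonneg _ _))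
      have h3 : scalarOpNorm (v.map (bridgeFunctional f g)) ≤ 0 :=
        nonpos_of_mul_nonpos_right h3 hγ'
      have h3 := scalarOpNorm_eq_zero.1 (le_antisymm h3 (scalarOpNorm_nonneg _))
      refine ⟨lam, ?_⟩
      ext i j
      have e1 : (v i j).1 = lam i j • A.one := congrFun (congrFun h1 i) j
      have e2 : (v i j).2 = mu i j • B.one := congrFun (congrFun h2 i) j
      have e3 : f (v i j).1 - g (v i j).2 = 0 := congrFun (congrFun h3 i) j
      rw [e1, e2, map_smul, map_smul, hf.1, hg.1, sub_eq_zero, smul_eq_mul, smul_eq_mul, mul_one,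
        mul_one] at e3
      rw [← e3] at e2
      exact Prod.ext e1 e2
    · rintro ⟨lam, rfl⟩
      refine le_antisymm (glueSeminorm_le_iff.2 ⟨?_, ?_, ?_⟩)
        (le_max_of_le_left (le_max_of_le_left (hA.nonneg _ _)))
      · exact ((hA.null_iff _ _).2 ⟨lam, rfl⟩).le
      · exact ((hB.null_iff _ _).2 ⟨lam, rfl⟩).le
      · have : (Matrix.of fun i j => lam i j • (A.prod B).one).map (bridgeFunctional f g) = 0 := by
          ext i j
          change bridgeFunctional f g (lam i j • (A.prod B).one) = 0
          rw [map_smul]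
          change lam i j • (f A.one - g B.one) = 0
          rw [hf.1, hg.1, sub_self, smul_zero]
        rw [this, scalarOpNorm_zero, mul_zero]
  · simp only [glueSeminorm, map_eq_mapMat, mapMat_dsumMat, hA.dsum_eq, hB.dsum_eq,
      scalarOpNorm_dsumMat]
    rw [mul_max_of_nonneg _ _ hγ'.le]
    ac_rfl
  · obtain ⟨h1, h2, h3⟩ := glueSeminorm_le_iff.1 (le_refl (glueSeminorm LA LB f g γ m v))
    have hα := scalarOpNorm_nonneg α
    have hβ := scalarOpNorm_nonneg β
    refine glueSeminorm_le_iff.2 ⟨?_, ?_, ?_⟩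
    · rw [mapMat_mmulMat]
      exact (hA.mmul_le _ _ _ _ _).trans (by gcongr)
    · rw [mapMat_mmulMat]
      exact (hB.mmul_le _ _ _ _ _).trans (by gcongr)
    · rw [map_eq_mapMat, mapMat_mmulMat, mmulMat_eq_mul]
      calc γ⁻¹ * scalarOpNorm (α * mapMat (bridgeFunctional f g) v * β)
          ≤ γ⁻¹ * (scalarOpNorm α * scalarOpNorm (mapMat (bridgeFunctional f g) v) *
              scalarOpNorm β) := by
            grw [scalarOpNorm_mul_le, scalarOpNorm_mul_le]
        _ = scalarOpNorm α * (γ⁻¹ * scalarOpNorm (mapMat (bridgeFunctional f g) v)) *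
              scalarOpNorm β := by ring
        _ ≤ _ := by gcongr; exact h3
  · have e : v.conjTranspose.map (bridgeFunctional f g) =
        (v.map (bridgeFunctional f g)).conjTranspose := by
      ext i j
      exact bridgeFunctional_star hf hg _
    have e1 : mapMat (fstL A B) v.conjTranspose = (mapMat (fstL A B) v).conjTranspose := rfl
    have e2 : mapMat (sndL A B) v.conjTranspose = (mapMat (sndL A B) v).conjTranspose := rfl
    simp only [glueSeminorm]
    rw [e, e1, e2, hA.star_eq, hB.star_eq, scalarOpNorm_conjTranspose]

lemma glueSeminorm_induces_fst (hA : IsMatrixLipschitzSeminorm A LA)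
    (hB : IsMatrixLipschitzSeminorm B LB) (hg : IsState B g) :
    Induces (A.prod B) A (fstL A B) (glueSeminorm LA LB f g γ) LA := by
  intro n a
  refine (IsLeast.csInf_eq ?_).symm
  refine ⟨⟨(Matrix.of fun i j => (a i j, f (a i j) • B.one) :
    Matrix (Fin n) (Fin n) (A.prod B).carrier), rfl, ?_⟩, ?_⟩
  · refine le_antisymm (le_max_of_le_left (le_max_left _ _))
      (glueSeminorm_le_iff.2 ⟨le_rfl, ?_, ?_⟩)
    · exact ((hB.null_iff _ _).2 ⟨a.map f, rfl⟩).le.trans (hA.nonneg _ _)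
    · refine le_of_eq_of_le ?_ (hA.nonneg n a)
      rw [mul_eq_zero, scalarOpNorm_eq_zero]
      right
      ext i j
      change f (a i j) - g (f (a i j) • B.one) = 0
      rw [map_smul, hg.1, smul_eq_mul, mul_one, sub_self]
  · rintro _ ⟨c, rfl, rfl⟩
    exact le_max_of_le_left (le_max_left _ _)

lemma glueSeminorm_induces_snd (hA : IsMatrixLipschitzSeminorm A LA)
    (hB : IsMatrixLipschitzSeminorm B LB) (hf : IsState A f) :
    Induces (A.prod B) B (sndL A B) (glueSeminorm LA LB f g γ) LB := by
  intro n b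
  refine (IsLeast.csInf_eq ?_).symm
  refine ⟨⟨(Matrix.of fun i j => (g (b i j) • A.one, b i j) :
    Matrix (Fin n) (Fin n) (A.prod B).carrier), rfl, ?_⟩, ?_⟩
  · refine le_antisymm (le_max_of_le_left (le_max_right _ _))
      (glueSeminorm_le_iff.2 ⟨?_, le_rfl, ?_⟩)
    · exact ((hA.null_iff _ _).2 ⟨b.map g, rfl⟩).le.trans (hB.nonneg _ _)
    · refine le_of_eq_of_le ?_ (hB.nonneg n b)
      rw [mul_eq_zero, scalarOpNorm_eq_zero]
      right
      ext i j
      change f (g (b i j) • A.one) - g (b i j) = 0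
      rw [map_smul, hf.1, smul_eq_mul, mul_one, sub_self]
  · rintro _ ⟨c, rfl, rfl⟩
    exact le_max_of_le_left (le_max_right _ _)

/-- The unital completely positive map on the first summand obtained from a matrix state of the
direct sum by letting the state `f` carry the mass of the second summand. -/
def compressFst (f : A.carrier →ₗ[ℂ] ℂ) (Φ : MState (A.prod B) n) : MState A n :=
  Φ.comp (LinearMap.inl ℂ A.carrier B.carrier) +
    f.smulRight (Φ ((0, B.one) : A.carrier × B.carrier))

/-- The analogue of `compressFst` for the second summand. -/
def compressSnd (g : B.carrier →ₗ[ℂ] ℂ) (Φ : MState (A.prod B) n) : MState B n :=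
  Φ.comp (LinearMap.inr ℂ A.carrier B.carrier) +
    g.smulRight (Φ ((A.one, 0) : A.carrier × B.carrier))

lemma zero_mem_pos (A : MOUS) (n : ℕ) : (0 : Matrix (Fin n) (Fin n) A.carrier) ∈ A.pos n := by
  have := A.pos_smul n 0 le_rfl _ (A.unit_pos n)
  simpa using this

lemma one_mem_pos (A : MOUS) :
    (Matrix.of fun _ _ => A.one : Matrix (Fin 1) (Fin 1) A.carrier) ∈ A.pos 1 := by
  convert A.unit_pos 1 using 2
  ext i j
  simp [Subsingleton.elim i j]

lemma posSemidef_apply_of_mem_pos {Φ : MState A n} (hΦ : Φ ∈ CS A n) {v : A.carrier}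
    (hv : (Matrix.of fun _ _ => v : Matrix (Fin 1) (Fin 1) A.carrier) ∈ A.pos 1) :
    (Φ v).PosSemidef :=
  (hΦ.2 1 _ hv).submatrix fun k : Fin n => ((0 : Fin 1), k)

lemma compress_add (Φ : MState (A.prod B) n) : Φ ((A.one, 0) : A.carrier × B.carrier) +
    Φ ((0, B.one) : A.carrier × B.carrier) = Φ (A.prod B).one := by
  refine (map_add Φ _ _).symm.trans ?_
  congr 1
  exact Prod.ext (add_zero _) (zero_add _)

lemma compressFst_mem_CS (hf : IsState A f) {Φ : MState (A.prod B) n} (hΦ : Φ ∈ CS (A.prod B) n) :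
    compressFst f Φ ∈ CS A n := by
  refine ⟨?_, fun r v hv => ?_⟩
  · have h := compress_add Φ
    rw [hΦ.1] at h
    rw [← h, compressFst, LinearMap.add_apply, LinearMap.smulRight_apply, hf.1, one_smul]
    rfl
  · rw [compressFst, mpair_add]
    refine Matrix.PosSemidef.add ?_ (hf.smulRight_posSemidef ?_ hv)
    · exact hΦ.2 r (Matrix.of fun i j => (v i j, 0)) ⟨hv, zero_mem_pos B r⟩
    · exact posSemidef_apply_of_mem_pos hΦ ⟨zero_mem_pos A 1, one_mem_pos B⟩

lemma compressSnd_mem_CS (hg : IsState B g) {Φ : MState (A.prod B) n} (hΦ : Φ ∈ CS (A.prod B) n) :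
    compressSnd g Φ ∈ CS B n := by
  refine ⟨?_, fun r v hv => ?_⟩
  · have h := compress_add Φ
    rw [hΦ.1] at h
    rw [← h, compressSnd, LinearMap.add_apply, LinearMap.smulRight_apply, hg.1, one_smul, add_comm]
    rfl
  · rw [compressSnd, mpair_add]
    refine Matrix.PosSemidef.add ?_ (hg.smulRight_posSemidef ?_ hv)
    · exact hΦ.2 r (Matrix.of fun i j => (0, v i j)) ⟨zero_mem_pos A r, hv⟩
    · exact posSemidef_apply_of_mem_pos hΦ ⟨one_mem_pos A, zero_mem_pos B 1⟩

lemma mpair_sub_eq_compress {Φ Ψ : MState (A.prod B) n} (hΦ : Φ ∈ CS (A.prod B) n)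
    (hΨ : Ψ ∈ CS (A.prod B) n) (c : Matrix (Fin r) (Fin r) (A.prod B).carrier) :
    mpair Φ c - mpair Ψ c =
      (mpair (compressFst f Φ) (mapMat (fstL A B) c) -
          mpair (compressFst f Ψ) (mapMat (fstL A B) c)) +
        (mpair (compressSnd g Φ) (mapMat (sndL A B) c) -
          mpair (compressSnd g Ψ) (mapMat (sndL A B) c)) +
        Matrix.kronecker (c.map (bridgeFunctional f g))
          (Φ ((A.one, 0) : A.carrier × B.carrier) - Ψ ((A.one, 0) : A.carrier × B.carrier)) := by
  have hsplit : ∀ (Θ : MState (A.prod B) n) (x : (A.prod B).carrier),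
      Θ x = Θ ((x.1, 0) : A.carrier × B.carrier) + Θ ((0, x.2) : A.carrier × B.carrier) := by
    intro Θ x
    refine Eq.trans ?_ (map_add Θ _ _)
    congr 1
    exact Prod.ext (add_zero _).symm (zero_add _).symm
  have h1 := compress_add Φ
  have h2 := compress_add Ψ
  rw [hΦ.1] at h1
  rw [hΨ.1] at h2
  ext ⟨i, k⟩ ⟨j, l⟩
  have e1 := congrFun (congrFun (h1.trans h2.symm) k) l
  have e2 := congrFun (congrFun (hsplit Φ (c i j)) k) l
  have e3 := congrFun (congrFun (hsplit Ψ (c i j)) k) l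
  rw [Matrix.add_apply] at e2 e3
  rw [Matrix.add_apply, Matrix.add_apply] at e1
  change Φ (c i j) k l - Ψ (c i j) k l =
    ((Φ ((c i j).1, 0) k l + f (c i j).1 * Φ (0, B.one) k l) -
      (Ψ ((c i j).1, 0) k l + f (c i j).1 * Ψ (0, B.one) k l)) +
    ((Φ (0, (c i j).2) k l + g (c i j).2 * Φ (A.one, 0) k l) -
      (Ψ (0, (c i j).2) k l + g (c i j).2 * Ψ (A.one, 0) k l)) +
    (f (c i j).1 - g (c i j).2) * (Φ (A.one, 0) k l - Ψ (A.one, 0) k l)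
  linear_combination e2 - e3 - f (c i j).1 * e1

lemma DBound_glueSeminorm (hγ : 0 < γ) {Φ Ψ : MState (A.prod B) n} (hΦ : Φ ∈ CS (A.prod B) n)
    (hΨ : Ψ ∈ CS (A.prod B) n) {C D : ℝ}
    (hC : DBound A LA (compressFst f Φ) (compressFst f Ψ) C)
    (hD : DBound B LB (compressSnd g Φ) (compressSnd g Ψ) D) :
    DBound (A.prod B) (glueSeminorm LA LB f g γ) Φ Ψ (C + D + γ * ∑ k, ∑ l,
      ‖Φ ((A.one, 0) : A.carrier × B.carrier) k l -
        Ψ ((A.one, 0) : A.carrier × B.carrier) k l‖) := by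
  intro r c hc
  obtain ⟨h1, h2, h3⟩ := glueSeminorm_le_iff.1 hc
  rw [inv_mul_le_iff₀ hγ, mul_one] at h3
  rw [mpair_sub_eq_compress (f := f) (g := g) hΦ hΨ]
  refine (scalarOpNorm_add_le _ _).trans (add_le_add ((scalarOpNorm_add_le _ _).trans
    (add_le_add (hC r _ h1) (hD r _ h2))) ?_)
  refine (scalarOpNorm_kronecker_le _ _).trans ?_
  simp only [Matrix.sub_apply]
  gcongr

lemma glueSeminorm_isMatrixLipNorm (hA : IsMatrixLipNorm A LA) (hB : IsMatrixLipNorm B LB)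
    (hf : IsState A f) (hg : IsState B g) (hγ : 0 < γ) :
    IsMatrixLipNorm (A.prod B) (glueSeminorm LA LB f g γ) := by
  have hS := glueSeminorm_isMatrixLipschitzSeminorm hA.toIsMatrixLipschitzSeminorm
    hB.toIsMatrixLipschitzSeminorm hf hg hγ
  refine ⟨hS, fun n => Dtop_eq_BWtop_of_eventually hS ?_ ?_⟩
  · intro φ hφ ψ hψ
    obtain ⟨C, hC⟩ := hA.exists_DBound (compressFst_mem_CS hf hφ) (compressFst_mem_CS hf hψ)
    obtain ⟨D, hD⟩ := hB.exists_DBound (compressSnd_mem_CS hg hφ) (compressSnd_mem_CS hg hψ)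
    exact ⟨_, DBound_glueSeminorm hγ hφ hψ hC hD⟩
  · intro Φ ε hε
    have hlim := tendsto_nhds_BWtop_iff (l := @nhds _ (BWtop (A.prod B) n) Φ) (g := id).1
      Filter.tendsto_id
    have hFst := hA.eventually_Dmet_lt (l := @nhds _ (BWtop (A.prod B) n) Φ)
      (g := fun Ψ => ⟨compressFst f Ψ.1, compressFst_mem_CS hf Ψ.2⟩)
      (Φ := ⟨compressFst f Φ.1, compressFst_mem_CS hf Φ.2⟩)
      (fun a i j => (hlim (a, 0) i j).add ((hlim (0, B.one) i j).const_mul (f a)))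
      (ε := ε / 3) (by positivity)
    have hSnd := hB.eventually_Dmet_lt (l := @nhds _ (BWtop (A.prod B) n) Φ)
      (g := fun Ψ => ⟨compressSnd g Ψ.1, compressSnd_mem_CS hg Ψ.2⟩)
      (Φ := ⟨compressSnd g Φ.1, compressSnd_mem_CS hg Φ.2⟩)
      (fun b i j => (hlim (0, b) i j).add ((hlim (A.one, 0) i j).const_mul (g b)))
      (ε := ε / 3) (by positivity)
    have hUnit : Filter.Tendsto (fun Ψ : {φ : MState (A.prod B) n // φ ∈ CS (A.prod B) n} =>
        γ * ∑ k, ∑ l, ‖Φ.1 ((A.one, 0) : A.carrier × B.carrier) k l -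
          Ψ.1 ((A.one, 0) : A.carrier × B.carrier) k l‖)
        (@nhds _ (BWtop (A.prod B) n) Φ) (nhds 0) := by
      have h0 : (0 : ℝ) = γ * ∑ k, ∑ l, ‖Φ.1 ((A.one, 0) : A.carrier × B.carrier) k l -
          Φ.1 ((A.one, 0) : A.carrier × B.carrier) k l‖ := by simp
      rw [h0]
      exact (tendsto_finsetSum _ fun k _ => tendsto_finsetSum _ fun l _ =>
        ((hlim (A.one, 0) k l).const_sub _).norm).const_mul γ
    filter_upwards [hFst, hSnd, hUnit.eventually_lt_const (u := ε / 3) (by positivity)]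
      with Ψ h1 h2 h3
    obtain ⟨C, hC⟩ := hA.exists_DBound (compressFst_mem_CS hf Φ.2) (compressFst_mem_CS hf Ψ.2)
    obtain ⟨D, hD⟩ := hB.exists_DBound (compressSnd_mem_CS hg Φ.2) (compressSnd_mem_CS hg Ψ.2)
    refine lt_of_le_of_lt (Dmet_le ?_ (DBound_glueSeminorm hγ Φ.2 Ψ.2 hC.dmet hD.dmet)) ?_
    · have := Dmet_nonneg (L := LA) (compressFst f Φ.1) (compressFst f Ψ.1)
      have := Dmet_nonneg (L := LB) (compressSnd g Φ.1) (compressSnd g Ψ.1)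
      positivity
    · linarith

end Glue

section Hausdorff

variable {X : Type} {d : X → X → ℝ} {s t : Set X}

lemma hDist_nonneg (hd : ∀ x y, 0 ≤ d x y) : 0 ≤ hDist d s t := by
  refine le_max_of_le_left (Real.sSup_nonneg ?_)
  rintro _ ⟨x, _, rfl⟩
  refine Real.sInf_nonneg ?_
  rintro _ ⟨y, _, rfl⟩
  exact hd x y

lemma hDist_le (hd : ∀ x y, 0 ≤ d x y) {C : ℝ} (hC : 0 ≤ C) (h1 : ∀ x ∈ s, ∃ y ∈ t, d x y ≤ C)
    (h2 : ∀ y ∈ t, ∃ x ∈ s, d x y ≤ C) : hDist d s t ≤ C := by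
  refine max_le (Real.sSup_le ?_ hC) (Real.sSup_le ?_ hC)
  · rintro _ ⟨x, hx, rfl⟩
    obtain ⟨y, hy, hxy⟩ := h1 x hx
    refine (csInf_le ⟨0, ?_⟩ (Set.mem_image_of_mem _ hy)).trans hxy
    rintro _ ⟨y, _, rfl⟩
    exact hd x y
  · rintro _ ⟨y, hy, rfl⟩
    obtain ⟨x, hx, hxy⟩ := h2 y hy
    refine (csInf_le ⟨0, ?_⟩ (Set.mem_image_of_mem _ hx)).trans hxy
    rintro _ ⟨x, _, rfl⟩
    exact hd x y

lemma hDist_of_eq_empty (h : s = ∅ ∨ t = ∅) : hDist d s t ≤ 0 := by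
  rcases h with rfl | rfl <;>
    refine max_le (Real.sSup_le ?_ le_rfl) (Real.sSup_le ?_ le_rfl) <;>
    rintro _ ⟨x, hx, rfl⟩ <;> simp at *

end Hausdorff

section Distance

variable {A B : MOUS} {LA : ∀ n : ℕ, Matrix (Fin n) (Fin n) A.carrier → ℝ}
  {LB : ∀ n : ℕ, Matrix (Fin n) (Fin n) B.carrier → ℝ}
  {f : A.carrier →ₗ[ℂ] ℂ} {g : B.carrier →ₗ[ℂ] ℂ} {γ : ℝ} {n : ℕ}

lemma CS_eq_empty_of_forall_not_isState (h : ∀ f, ¬ IsState A f) (hn : n ≠ 0) : CS A n = ∅ := by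
  refine Set.eq_empty_of_forall_notMem fun φ hφ => ?_
  have : NeZero n := ⟨hn⟩
  exact h _ (vecFunctional_isState hφ (ξ := Pi.single 0 1) (by simp))

lemma distNC_bddBelow : BddBelow {x | ∃ L ∈ MSet A LA B LB, x = ⨆ n : ℕ, ((n : ℝ) ^ 2)⁻¹ *
    hDist (Dmet (A.prod B) L n)
      ((fun φ : MState A n => φ.comp (fstL A B)) '' CS A n)
      ((fun φ : MState B n => φ.comp (sndL A B)) '' CS B n)} := by
  refine ⟨0, ?_⟩
  rintro _ ⟨L, _, rfl⟩
  exact Real.iSup_nonneg fun n => mul_nonneg (by positivity) (hDist_nonneg Dmet_nonneg)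

lemma distNC_nonpos_of_forall_not_isState
    (h : (∀ f, ¬ IsState A f) ∨ ∀ g, ¬ IsState B g) : distNC A LA B LB ≤ 0 := by
  refine Real.sInf_nonpos ?_
  rintro _ ⟨L, _, rfl⟩
  refine Real.iSup_le (fun n => ?_) le_rfl
  rcases eq_or_ne n 0 with rfl | hn
  · simp
  · refine mul_nonpos_of_nonneg_of_nonpos (by positivity) (hDist_of_eq_empty ?_)
    exact h.imp (fun h => by rw [CS_eq_empty_of_forall_not_isState h hn, Set.image_empty])
      fun h => by rw [CS_eq_empty_of_forall_not_isState h hn, Set.image_empty]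

lemma DBound_glueSeminorm_smulRight_one (hγ : 0 < γ) :
    DBound (A.prod B) (glueSeminorm LA LB f g γ)
      ((f.smulRight 1 : MState A n).comp (fstL A B))
      ((g.smulRight 1 : MState B n).comp (sndL A B)) ((n : ℝ) ^ 2 * γ) := by
  intro r c hc
  obtain ⟨-, -, h⟩ := glueSeminorm_le_iff.1 hc
  rw [inv_mul_le_iff₀ hγ, mul_one] at h
  have e : mpair ((f.smulRight 1 : MState A n).comp (fstL A B)) c -
      mpair ((g.smulRight 1 : MState B n).comp (sndL A B)) c =
      Matrix.kronecker (c.map (bridgeFunctional f g)) (1 : Matrix (Fin n) (Fin n) ℂ) := by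
    ext ⟨i, k⟩ ⟨j, l⟩
    exact (sub_mul _ _ _).symm
  have hsum : ∑ k, ∑ l, ‖(1 : Matrix (Fin n) (Fin n) ℂ) k l‖ ≤ (n : ℝ) ^ 2 := by
    calc ∑ k, ∑ l, ‖(1 : Matrix (Fin n) (Fin n) ℂ) k l‖ ≤ ∑ _k : Fin n, ∑ _l : Fin n, (1 : ℝ) := by
          refine Finset.sum_le_sum fun k _ => Finset.sum_le_sum fun l _ => ?_
          rw [Matrix.one_apply]
          split_ifs <;> simp
      _ = (n : ℝ) ^ 2 := by simp [sq]
  rw [e, mul_comm]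
  exact (scalarOpNorm_kronecker_le _ _).trans
    (mul_le_mul h hsum (by positivity) hγ.le)

lemma DBound.comp_fstL {φ ψ : MState A n} {C : ℝ} (h : DBound A LA φ ψ C) :
    DBound (A.prod B) (glueSeminorm LA LB f g γ) (φ.comp (fstL A B)) (ψ.comp (fstL A B)) C :=
  fun r c hc => h r (mapMat (fstL A B) c) (glueSeminorm_le_iff.1 hc).1

lemma DBound.comp_sndL {φ ψ : MState B n} {C : ℝ} (h : DBound B LB φ ψ C) :
    DBound (A.prod B) (glueSeminorm LA LB f g γ) (φ.comp (sndL A B)) (ψ.comp (sndL A B)) C :=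
  fun r c hc => h r (mapMat (sndL A B) c) (glueSeminorm_le_iff.1 hc).2.1

lemma hDist_glueSeminorm_le (hA : IsMatrixLipNorm A LA) (hB : IsMatrixLipNorm B LB)
    (hf : IsState A f) (hg : IsState B g) (hγ : 0 < γ) :
    hDist (Dmet (A.prod B) (glueSeminorm LA LB f g γ) n)
      ((fun φ : MState A n => φ.comp (fstL A B)) '' CS A n)
      ((fun φ : MState B n => φ.comp (sndL A B)) '' CS B n) ≤
      (n : ℝ) ^ 2 * (qDiam A LA + qDiam B LB + γ) := by
  have hdA : 0 ≤ qDiam A LA := qDiam_nonneg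
  have hdB : 0 ≤ qDiam B LB := qDiam_nonneg
  have hC : 0 ≤ (n : ℝ) ^ 2 * (qDiam A LA + qDiam B LB + γ) := by positivity
  have hbridge := DBound_glueSeminorm_smulRight_one (LA := LA) (LB := LB) (f := f) (g := g)
    (n := n) hγ
  refine hDist_le Dmet_nonneg hC ?_ ?_
  · rintro _ ⟨φ, hφ, rfl⟩
    refine ⟨_, ⟨_, hg.smulRight_one_mem_CS n, rfl⟩, Dmet_le hC fun r c hc => ?_⟩
    refine ((hA.DBound_smulRight_one hφ hf).comp_fstL.trans hbridge r c hc).trans ?_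
    rw [← mul_add]
    exact mul_le_mul_of_nonneg_left (by linarith) (by positivity)
  · rintro _ ⟨ψ, hψ, rfl⟩
    refine ⟨_, ⟨_, hf.smulRight_one_mem_CS n, rfl⟩, Dmet_le hC fun r c hc => ?_⟩
    refine (hbridge.trans (hB.DBound_smulRight_one hψ hg).symm.comp_sndL r c hc).trans ?_
    rw [← mul_add]
    exact mul_le_mul_of_nonneg_left (by linarith) (by positivity)

lemma distNC_le_of_isState (hA : IsMatrixLipNorm A LA) (hB : IsMatrixLipNorm B LB)
    (hf : IsState A f) (hg : IsState B g) : distNC A LA B LB ≤ qDiam A LA + qDiam B LB := by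
  have hdA : 0 ≤ qDiam A LA := qDiam_nonneg
  have hdB : 0 ≤ qDiam B LB := qDiam_nonneg
  refine le_of_forall_pos_le_add fun γ hγ => ?_
  have hSA := hA.toIsMatrixLipschitzSeminorm
  have hSB := hB.toIsMatrixLipschitzSeminorm
  refine (csInf_le distNC_bddBelow ⟨glueSeminorm LA LB f g γ,
    ⟨glueSeminorm_isMatrixLipNorm hA hB hf hg hγ, glueSeminorm_induces_fst hSA hSB hg,
      glueSeminorm_induces_snd hSA hSB hf⟩, rfl⟩).trans (Real.iSup_le (fun n => ?_) (by positivity))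
  rcases eq_or_ne n 0 with rfl | hn
  · have : 0 ≤ qDiam A LA + qDiam B LB + γ := by positivity
    simpa using this
  · rw [inv_mul_le_iff₀ (by positivity)]
    exact hDist_glueSeminorm_le hA hB hf hg hγ

end Distance

/-- Proposition 4.6 of the paper.  For any quantized metric spaces
`(V₁, L₁)` and `(V₂, L₂)`, the quantized Gromov–Hausdorff distance satisfies
`dist_NC(V₁, V₂) ≤ 2 (diam(V₁, L₁) + diam(V₂, L₂))`. -/
theorem distNC_le_diams (A B : MOUS)
    (LA : ∀ n : ℕ, Matrix (Fin n) (Fin n) A.carrier → ℝ)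
    (LB : ∀ n : ℕ, Matrix (Fin n) (Fin n) B.carrier → ℝ)
    (hA : IsMatrixLipNorm A LA) (hB : IsMatrixLipNorm B LB) :
    distNC A LA B LB ≤ 2 * (qDiam A LA + qDiam B LB) := by
  have hdA : 0 ≤ qDiam A LA := qDiam_nonneg
  have hdB : 0 ≤ qDiam B LB := qDiam_nonneg
  by_cases h : (∃ f, IsState A f) ∧ ∃ g, IsState B g
  · obtain ⟨⟨f, hf⟩, g, hg⟩ := h
    linarith [distNC_le_of_isState hA hB hf hg]
  · rw [not_and_or, not_exists, not_exists] at h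
    linarith [distNC_nonpos_of_forall_not_isState (LA := LA) (LB := LB) h]

end
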